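/- arXiv:0712.3213 — 5 statements merged into one kernel-verified Lean document; each statement's English description precedes it below -/
import Mathlib

section
/- Fix integers a, b with 0 ≤ a < b and set c = a + b. For n ≥ 0 let p_n = (cn + b − a − 1, 2n), and let M_i = ((b−a)/(ci+b))·binomial((c+2)i + b, 2i + 1) and N_n = ((b−a)/(cn+b−a))·binomial((c+2)n + b − a − 1, 2n). Then the number of lattice paths from (0,0) with terminus p_n that lie weakly under ∂_{b,a} equals N_n − (1/2)·Σ_{i=0}^{n−1} M_i·M_{n−1−i}. -/
/-- The `d`-th abscissa `s_d` of the infinite periodic boundary `∂_{u,v}`: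
`s_{2q} = q(u+v)` and `s_{2q+1} = q(u+v) + u`. -/
def stairAbscissa (u v d : ℕ) : ℕ :=
  (d / 2) * (u + v) + (if d % 2 = 1 then u else 0)

/-- A lattice path is a list of steps: `false` = R-step `(1,0)`, `true` = U-step `(0,1)`,
starting at the origin.  `UnderPeriodic u v P` says `P` lies weakly under the infinite
periodic boundary `∂_{u,v}`: for every `d` with `0 ≤ d <` (number of U-steps of `P`),
the number of R-steps of `P` preceding its `(d+1)`-st U-step is at least `s_{d+1}`. -/
def UnderPeriodic (u v : ℕ) (P : List Bool) : Prop :=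
  ∀ q r : List Bool, P = q ++ true :: r →
    stairAbscissa u v (q.count true + 1) ≤ q.count false

/-- `M_i = ((b-a)/(ci+b)) · C((c+2)i + b, 2i+1)`. -/
noncomputable def Mq (a b c i : ℕ) : ℚ :=
  (((b : ℚ) - a) / ((c : ℚ) * i + b)) * (((c + 2) * i + b).choose (2 * i + 1) : ℚ)

/-- `N_n = ((b-a)/(cn+b-a)) · C((c+2)n + b - a - 1, 2n)`. -/
noncomputable def Nq (a b c n : ℕ) : ℚ :=
  (((b : ℚ) - a) / ((c : ℚ) * n + b - a)) * (((c + 2) * n + b - a - 1).choose (2 * n) : ℚ)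

open Polynomial in
/-- The polynomial `y / (y + βl) · C(y + βl, l)` in `y`: the `l`-th coefficient of the `y`-th power
of the generalized binomial series `B = 1 + t B ^ β`. -/
noncomputable def rothePoly (β : ℚ) : ℕ → ℚ[X]
  | 0 => 1
  | l + 1 => C (((l + 1).factorial : ℚ)⁻¹) * X *
      (descPochhammer ℚ l).comp (X + C (β * (l + 1) - 1))

/-- The `y`-th power of the generalized binomial series `B = 1 + t B ^ β`. -/
noncomputable def rotheSeries (β y : ℚ) : PowerSeries ℚ :=
  PowerSeries.mk fun l => (rothePoly β l).eval y

section Rothe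

open Polynomial

theorem eval_rothePoly_succ (β y : ℚ) (l : ℕ) :
    (rothePoly β (l + 1)).eval y =
      ((l + 1).factorial : ℚ)⁻¹ * y * (descPochhammer ℚ l).eval (y + (β * (l + 1) - 1)) := by
  simp [rothePoly]

theorem eval_descPochhammer_succ_left (n : ℕ) (x : ℚ) :
    (descPochhammer ℚ (n + 1)).eval x = x * (descPochhammer ℚ n).eval (x - 1) := by
  simp [descPochhammer_succ_left]

theorem eval_descPochhammer_succ_right (n : ℕ) (x : ℚ) :
    (descPochhammer ℚ (n + 1)).eval x = (descPochhammer ℚ n).eval x * (x - n) := by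
  simp [descPochhammer_succ_right]

theorem eval_zero_rothePoly_succ (β : ℚ) (l : ℕ) : (rothePoly β (l + 1)).eval 0 = 0 := by
  simp [rothePoly]

theorem eval_add_one_rothePoly_succ (β y : ℚ) (l : ℕ) :
    (rothePoly β (l + 1)).eval (y + 1) =
      (rothePoly β (l + 1)).eval y + (rothePoly β l).eval (y + β) := by
  cases l with
  | zero => simp [rothePoly]
  | succ l =>
    rw [eval_rothePoly_succ, eval_rothePoly_succ, eval_rothePoly_succ,
      eval_descPochhammer_succ_left, eval_descPochhammer_succ_right,
      Nat.factorial_succ (l + 1)]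
    have hl : ((l + 1).factorial : ℚ) ≠ 0 := by positivity
    have hl' : (l : ℚ) + 1 + 1 ≠ 0 := by positivity
    push_cast
    have e₁ : y + 1 + (β * (l + 1 + 1) - 1) - 1 = y + (β * (l + 1 + 1) - 1) := by ring
    have e₂ : y + β + (β * (l + 1) - 1) = y + (β * (l + 1 + 1) - 1) := by ring
    rw [e₁, e₂]
    field_simp
    ring

theorem eval_rothePoly_mul (β y : ℚ) (l : ℕ) :
    (rothePoly β l).eval y * (y + β * l - l) =
      y * ((descPochhammer ℚ l).eval (y + β * l - 1) / l.factorial) := by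
  cases l with
  | zero => simp [rothePoly]
  | succ l =>
    rw [eval_rothePoly_succ, eval_descPochhammer_succ_right, ← add_sub_assoc, Nat.cast_succ]
    field_simp
    ring

theorem eval_rothePoly_eq_choose {β y : ℚ} {l K : ℕ} (hK : (K : ℚ) = y + β * l - 1)
    (h : y + β * l - l ≠ 0) :
    (rothePoly β l).eval y = y / (y + β * l - l) * (K.choose l : ℚ) := by
  have hm := eval_rothePoly_mul β y l
  rw [← hK, descPochhammer_eval_eq_descFactorial, Nat.descFactorial_eq_factorial_mul_choose,
    Nat.cast_mul, mul_div_cancel_left₀ _ (by positivity : (l.factorial : ℚ) ≠ 0)] at hm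
  rw [div_mul_eq_mul_div, eq_div_iff h, hm]

theorem coeff_rotheSeries (β y : ℚ) (l : ℕ) :
    PowerSeries.coeff l (rotheSeries β y) = (rothePoly β l).eval y :=
  PowerSeries.coeff_mk _ _

theorem constantCoeff_rotheSeries (β y : ℚ) :
    PowerSeries.constantCoeff (rotheSeries β y) = 1 := by
  rw [← PowerSeries.coeff_zero_eq_constantCoeff_apply, coeff_rotheSeries]
  simp [rothePoly]

theorem rotheSeries_zero (β : ℚ) : rotheSeries β 0 = 1 := by
  ext l
  rw [coeff_rotheSeries, PowerSeries.coeff_one]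
  cases l with
  | zero => simp [rothePoly]
  | succ l => simp [eval_zero_rothePoly_succ]

theorem rotheSeries_add_one (β y : ℚ) :
    rotheSeries β (y + 1) = rotheSeries β y + PowerSeries.X * rotheSeries β (y + β) := by
  ext l
  cases l with
  | zero => simp [constantCoeff_rotheSeries]
  | succ l =>
    simp [PowerSeries.coeff_succ_X_mul, coeff_rotheSeries, eval_add_one_rothePoly_succ]

/-- The Rothe–Hagen identity. -/
theorem rotheSeries_add (β y z : ℚ) :
    rotheSeries β (y + z) = rotheSeries β y * rotheSeries β z := by
  ext l
  induction l generalizing y with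
  | zero => simp [constantCoeff_rotheSeries]
  | succ l ih =>
    let p : ℚ[X] := (rothePoly β (l + 1)).comp (X + C z) -
      ∑ ij ∈ Finset.HasAntidiagonal.antidiagonal (l + 1), rothePoly β ij.1 * C ((rothePoly β ij.2).eval z)
    have hp (x : ℚ) : p.eval x = PowerSeries.coeff (l + 1) (rotheSeries β (x + z)) -
        PowerSeries.coeff (l + 1) (rotheSeries β x * rotheSeries β z) := by
      simp [p, PowerSeries.coeff_mul, coeff_rotheSeries, eval_finsetSum]
    have hnat (k : ℕ) : p.eval (k : ℚ) = 0 := by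
      induction k with
      | zero => simp [hp, rotheSeries_zero]
      | succ k ihk =>
        rw [hp] at ihk ⊢
        have e : ((k + 1 : ℕ) : ℚ) + z = (k + z) + 1 := by push_cast; ring
        rw [e, rotheSeries_add_one, Nat.cast_succ, rotheSeries_add_one, add_mul, mul_assoc,
          map_add, map_add, PowerSeries.coeff_succ_X_mul, PowerSeries.coeff_succ_X_mul, ← ih,
          add_right_comm (k : ℚ) z β]
        linarith
    have hp0 : p = 0 :=
      Polynomial.eq_zero_of_infinite_isRoot p
        (Set.infinite_of_injective_forall_mem Nat.cast_injective hnat)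
    have := hp y
    rw [hp0, eval_zero] at this
    linarith

end Rothe

/-- The number of lattice paths with terminus `(k, l)` lying weakly under `∂_{u,v}`. -/
noncomputable def underCount (u v k l : ℕ) : ℕ :=
  Nat.card {P : List Bool // P.count false = k ∧ P.count true = l ∧ UnderPeriodic u v P}

section Count

variable {u v : ℕ}

theorem stairAbscissa_two_mul (u v q : ℕ) : stairAbscissa u v (2 * q) = q * (u + v) := by
  simp [stairAbscissa]

theorem stairAbscissa_two_mul_add_one (u v q : ℕ) :
    stairAbscissa u v (2 * q + 1) = q * (u + v) + u := by
  have h₁ : (2 * q + 1) / 2 = q := by omega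
  have h₂ : (2 * q + 1) % 2 = 1 := by omega
  simp [stairAbscissa, h₁, h₂]

theorem stairAbscissa_le_succ (u v d : ℕ) :
    stairAbscissa u v d ≤ stairAbscissa u v (d + 1) := by
  obtain ⟨q, rfl | rfl⟩ := Nat.even_or_odd' d
  · rw [stairAbscissa_two_mul, stairAbscissa_two_mul_add_one]
    omega
  · rw [stairAbscissa_two_mul_add_one, show 2 * q + 1 + 1 = 2 * (q + 1) by ring,
      stairAbscissa_two_mul, add_one_mul]
    omega

theorem stairAbscissa_succ_pos (hu : 0 < u) (d : ℕ) : 0 < stairAbscissa u v (d + 1) := by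
  induction d with
  | zero => simpa [stairAbscissa] using hu
  | succ d ih => exact ih.trans_le (stairAbscissa_le_succ u v (d + 1))

theorem underPeriodic_append_false {P : List Bool} :
    UnderPeriodic u v (P ++ [false]) ↔ UnderPeriodic u v P := by
  constructor
  · intro h q r hq
    exact h q (r ++ [false]) (by simp [hq])
  · intro h q r hq
    obtain rfl | ⟨r', x, rfl⟩ := r.eq_nil_or_concat
    · simpa using (List.append_inj' hq rfl).2
    · have hq' : P ++ [false] = (q ++ true :: r') ++ [x] := by simpa using hq
      exact h q r' (List.append_inj' hq' rfl).1

theorem underPeriodic_append_true {P : List Bool} :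
    UnderPeriodic u v (P ++ [true]) ↔
      UnderPeriodic u v P ∧ stairAbscissa u v (P.count true + 1) ≤ P.count false := by
  constructor
  · intro h
    exact ⟨fun q r hq => h q (r ++ [true]) (by simp [hq]), h P [] rfl⟩
  · rintro ⟨h, hP⟩ q r hq
    obtain rfl | ⟨r', x, rfl⟩ := r.eq_nil_or_concat
    · rwa [← (List.append_inj' hq rfl).1]
    · have hq' : P ++ [true] = (q ++ true :: r') ++ [x] := by simpa using hq
      exact h q r' (List.append_inj' hq' rfl).1

theorem finite_underPaths (u v k l : ℕ) :
    {P : List Bool | P.count false = k ∧ P.count true = l ∧ UnderPeriodic u v P}.Finite := by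
  refine (List.finite_length_eq Bool (k + l)).subset ?_
  rintro P ⟨rfl, rfl, -⟩
  exact (List.count_false_add_count_true P).symm

theorem underCount_eq_ncard (u v k l : ℕ) : underCount u v k l =
    {P : List Bool | P.count false = k ∧ P.count true = l ∧ UnderPeriodic u v P}.ncard :=
  rfl

theorem underCount_zero_right (u v k : ℕ) : underCount u v k 0 = 1 := by
  rw [underCount_eq_ncard, Set.ncard_eq_one]
  refine ⟨List.replicate k false, Set.eq_singleton_iff_unique_mem.2 ⟨?_, ?_⟩⟩
  · refine ⟨by simp, by simp [List.count_replicate], fun q r h => ?_⟩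
    have : true ∈ List.replicate k false := by simp [h]
    simp at this
  · rintro P ⟨hf, ht, -⟩
    refine List.eq_replicate_iff.2 ⟨?_, fun x hx => ?_⟩
    · rw [← List.count_false_add_count_true P, hf, ht, add_zero]
    · cases x with
      | false => rfl
      | true => exact absurd hx (List.count_eq_zero.1 ht)

theorem underCount_eq_zero {k l : ℕ} (h : k < stairAbscissa u v (l + 1)) :
    underCount u v k (l + 1) = 0 := by
  rw [underCount_eq_ncard, Set.ncard_eq_zero (finite_underPaths ..), Set.eq_empty_iff_forall_notMem]
  rintro P ⟨hf, ht, hP⟩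
  induction P using List.reverseRecOn generalizing k with
  | nil => simp at ht
  | append_singleton P x ih =>
    cases x with
    | false =>
      refine ih (k := P.count false) ?_ rfl (by simpa using ht) (underPeriodic_append_false.1 hP)
      simp at hf
      omega
    | true =>
      have := (underPeriodic_append_true.1 hP).2
      simp only [List.count_append, List.count_singleton] at hf ht
      simp at hf ht
      rw [ht, hf] at this
      omega

theorem underCount_succ_succ {k l : ℕ} (h : stairAbscissa u v (l + 1) ≤ k + 1) :
    underCount u v (k + 1) (l + 1) = underCount u v k (l + 1) + underCount u v (k + 1) l := by
  simp only [underCount_eq_ncard]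
  have hinj (x : Bool) : Function.Injective fun P : List Bool => P ++ [x] :=
    List.append_left_injective [x]
  rw [← Set.ncard_image_of_injective {P : List Bool | P.count false = k ∧ _} (hinj false),
    ← Set.ncard_image_of_injective {P : List Bool | P.count false = k + 1 ∧ P.count true = l ∧ _}
      (hinj true),
    ← Set.ncard_union_eq _ ((finite_underPaths ..).image _) ((finite_underPaths ..).image _)]
  · congr 1
    ext P
    constructor
    · rintro ⟨hf, ht, hP⟩
      obtain rfl | ⟨P, x, rfl⟩ := P.eq_nil_or_concat
      · simp at hf
      · cases x with
        | false =>
          exact Or.inl ⟨P, ⟨by simpa using hf, by simpa using ht,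
            underPeriodic_append_false.1 (by simpa using hP)⟩, by simp⟩
        | true =>
          exact Or.inr ⟨P, ⟨by simpa using hf, by simpa using ht,
            (underPeriodic_append_true.1 (by simpa using hP)).1⟩, by simp⟩
    · rintro (⟨P, ⟨hf, ht, hP⟩, rfl⟩ | ⟨P, ⟨hf, ht, hP⟩, rfl⟩)
      · exact ⟨by simp [hf], by simp [ht], underPeriodic_append_false.2 hP⟩
      · exact ⟨by simp [hf], by simp [ht],
          underPeriodic_append_true.2 ⟨hP, by rwa [hf, ht]⟩⟩
  · rw [Set.disjoint_left]
    rintro _ ⟨P, -, rfl⟩ ⟨Q, -, hQ⟩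
    simpa using (List.append_inj' hQ rfl).2

end Count

section EvenPart

open PowerSeries

variable {R : Type*} [CommRing R]

theorem rescale_neg_one_rescale_neg_one (f : R⟦X⟧) :
    rescale (-1 : R) (rescale (-1 : R) f) = f := by
  rw [rescale_rescale]
  simp

theorem coeff_odd_eq_zero_of_rescale_neg_one_eq {f : ℚ⟦X⟧} (hf : rescale (-1 : ℚ) f = f) (n : ℕ) :
    coeff (2 * n + 1) f = 0 := by
  have h := congrArg (coeff (2 * n + 1)) hf
  rw [coeff_rescale, (odd_two_mul_add_one n).neg_one_pow] at h
  linarith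

theorem coeff_even_rescale_neg_one (f : R⟦X⟧) (n : ℕ) :
    coeff (2 * n) (rescale (-1 : R) f) = coeff (2 * n) f := by
  rw [coeff_rescale, (even_two_mul n).neg_one_pow, one_mul]

theorem coeff_odd_rescale_neg_one (f : R⟦X⟧) (n : ℕ) :
    coeff (2 * n + 1) (rescale (-1 : R) f) = -coeff (2 * n + 1) f := by
  rw [coeff_rescale, (odd_two_mul_add_one n).neg_one_pow, neg_one_mul]

theorem sum_range_two_mul_add_one {M : Type*} [AddCommMonoid M] (f : ℕ → M) (n : ℕ) :
    ∑ i ∈ Finset.range (2 * n + 1), f i =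
      ∑ i ∈ Finset.range n, f (2 * i + 1) + ∑ i ∈ Finset.range (n + 1), f (2 * i) := by
  induction n with
  | zero => simp
  | succ n ih =>
    rw [show 2 * (n + 1) + 1 = 2 * n + 1 + 1 + 1 by ring, Finset.sum_range_succ,
      Finset.sum_range_succ, ih, Finset.sum_range_succ (fun i => f (2 * i + 1)) n,
      Finset.sum_range_succ _ (n + 1), show 2 * (n + 1) = 2 * n + 1 + 1 by ring]
    abel

theorem coeff_even_sub_rescale_neg_one_sq (f : R⟦X⟧) (n : ℕ) :
    coeff (2 * n) ((f - rescale (-1 : R) f) ^ 2) =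
      ∑ i ∈ Finset.range n,
        2 * coeff (2 * i + 1) f * (2 * coeff (2 * (n - 1 - i) + 1) f) := by
  rw [sq, coeff_mul, Finset.Nat.sum_antidiagonal_eq_sum_range_succ_mk, Nat.succ_eq_add_one,
    sum_range_two_mul_add_one, Finset.sum_eq_zero (s := Finset.range (n + 1)), add_zero]
  · refine Finset.sum_congr rfl fun i hi => ?_
    have e : 2 * n - (2 * i + 1) = 2 * (n - 1 - i) + 1 := by
      have := Finset.mem_range.1 hi
      omega
    simp only [e, map_sub, coeff_odd_rescale_neg_one]
    ring
  · intro i _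
    simp

end EvenPart

section Solution

open PowerSeries

/-- The power series `2 W(-t) / (W(t) + W(-t))`. -/
noncomputable def boundarySeries (W : ℚ⟦X⟧) : ℚ⟦X⟧ :=
  2 * rescale (-1 : ℚ) W * (W + rescale (-1 : ℚ) W)⁻¹

variable {W : ℚ⟦X⟧}

theorem boundarySeries_mul (hW : constantCoeff W = 1) :
    boundarySeries W * (W + rescale (-1 : ℚ) W) = 2 * rescale (-1 : ℚ) W := by
  rw [boundarySeries, mul_assoc, PowerSeries.inv_mul_cancel, mul_one]
  rw [map_add, ← coeff_zero_eq_constantCoeff_apply (rescale (-1 : ℚ) W), coeff_rescale]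
  simp [hW]

theorem add_rescale_ne_zero (hW : constantCoeff W = 1) : W + rescale (-1 : ℚ) W ≠ 0 := by
  intro h
  have := congrArg (coeff 0) h
  rw [map_add, coeff_rescale] at this
  simp [hW] at this

theorem rescale_boundarySeries_mul (hW : constantCoeff W = 1) :
    rescale (-1 : ℚ) (boundarySeries W) * (W + rescale (-1 : ℚ) W) = 2 * W := by
  have h := congrArg (rescale (-1 : ℚ)) (boundarySeries_mul hW)
  simp only [map_mul, map_add, rescale_neg_one_rescale_neg_one, map_ofNat] at h
  rw [add_comm W, h]

theorem boundarySeries_add_rescale (hW : constantCoeff W = 1) :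
    boundarySeries W + rescale (-1 : ℚ) (boundarySeries W) = 2 := by
  apply mul_right_cancel₀ (add_rescale_ne_zero hW)
  rw [add_mul, boundarySeries_mul hW, rescale_boundarySeries_mul hW]
  ring

theorem constantCoeff_boundarySeries (hW : constantCoeff W = 1) :
    constantCoeff (boundarySeries W) = 1 := by
  have h := congrArg (coeff 0) (boundarySeries_add_rescale hW)
  rw [map_add, coeff_rescale, show (2 : ℚ⟦X⟧) = C (2 : ℚ) from (map_ofNat C 2).symm] at h
  simp at h
  linarith

theorem coeff_even_boundarySeries (hW : constantCoeff W = 1) (n : ℕ) :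
    coeff (2 * n + 2) (boundarySeries W) = 0 := by
  have h := congrArg (coeff (2 * (n + 1))) (boundarySeries_add_rescale hW)
  rw [map_add, coeff_even_rescale_neg_one, show (2 : ℚ⟦X⟧) = C (2 : ℚ) from (map_ofNat C 2).symm,
    coeff_C, if_neg (by omega)] at h
  rw [← mul_add_one]
  linarith

theorem rescale_boundarySeries_mul_self (hW : constantCoeff W = 1) :
    rescale (-1 : ℚ) (boundarySeries W * W) = boundarySeries W * W := by
  apply mul_right_cancel₀ (add_rescale_ne_zero hW)
  rw [map_mul]
  linear_combination rescale (-1 : ℚ) W * rescale_boundarySeries_mul hW -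
    W * boundarySeries_mul hW

theorem boundarySeries_mul_sq_add_rescale (hW : constantCoeff W = 1) :
    boundarySeries W * W ^ 2 + rescale (-1 : ℚ) (boundarySeries W * W ^ 2) =
      2 * (W * rescale (-1 : ℚ) W) := by
  apply mul_right_cancel₀ (add_rescale_ne_zero hW)
  rw [map_mul, map_pow]
  linear_combination (rescale (-1 : ℚ) W) ^ 2 * rescale_boundarySeries_mul hW +
    W ^ 2 * boundarySeries_mul hW

theorem coeff_even_boundarySeries_mul_sq (hW : constantCoeff W = 1) (n : ℕ) :
    coeff (2 * n) (boundarySeries W * W ^ 2) =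
      coeff (2 * n) (W ^ 2) - 1 / 2 * coeff (2 * n) ((W - rescale (-1 : ℚ) W) ^ 2) := by
  have h₁ := congrArg (coeff (2 * n)) (boundarySeries_mul_sq_add_rescale hW)
  have h₂ := congrArg (coeff (2 * n)) (show (W - rescale (-1 : ℚ) W) ^ 2 +
    2 * (W * rescale (-1 : ℚ) W) = W ^ 2 + rescale (-1 : ℚ) (W ^ 2) by rw [map_pow]; ring)
  simp only [map_add, coeff_even_rescale_neg_one] at h₁ h₂
  linarith

end Solution

open PowerSeries in
theorem underCount_eq_coeff {a b : ℕ} (hab : a < b) (l k : ℕ) (hk : stairAbscissa b a l ≤ k + 1) :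
    (underCount b a k l : ℚ) =
      coeff l (boundarySeries (rotheSeries (((a : ℚ) + b) / 2 + 1) (((b : ℚ) - a) / 2)) *
        rotheSeries (((a : ℚ) + b) / 2 + 1) (k + 1 - ((a : ℚ) + b) / 2 * l)) := by
  have hW := constantCoeff_rotheSeries (((a : ℚ) + b) / 2 + 1) (((b : ℚ) - a) / 2)
  induction l generalizing k with
  | zero => simp [underCount_zero_right, constantCoeff_boundarySeries hW,
      constantCoeff_rotheSeries]
  | succ l ihl =>
    obtain ⟨s, hs⟩ := Nat.exists_eq_add_one.2 (stairAbscissa_succ_pos (v := a) (by omega : 0 < b) l)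
    obtain ⟨m, rfl⟩ := Nat.exists_eq_add_of_le (show s ≤ k by omega)
    clear hk
    induction m with
    | zero =>
      rw [add_zero, underCount_eq_zero (by omega), Nat.cast_zero]
      symm
      obtain ⟨q, rfl | rfl⟩ := Nat.even_or_odd' l
      · rw [stairAbscissa_two_mul_add_one] at hs
        have hs' : (s : ℚ) + 1 = q * (b + a) + b := by exact_mod_cast hs.symm
        have e : (s : ℚ) + 1 - ((a : ℚ) + b) / 2 * ((2 * q + 1 : ℕ) : ℚ) = (b - a) / 2 := by
          rw [hs']
          push_cast
          ring
        rw [e]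
        exact coeff_odd_eq_zero_of_rescale_neg_one_eq (rescale_boundarySeries_mul_self hW) q
      · rw [show 2 * q + 1 + 1 = 2 * (q + 1) by ring, stairAbscissa_two_mul] at hs
        have hs' : (s : ℚ) + 1 = (q + 1) * (b + a) := by exact_mod_cast hs.symm
        have e : (s : ℚ) + 1 - ((a : ℚ) + b) / 2 * ((2 * q + 1 + 1 : ℕ) : ℚ) = 0 := by
          rw [hs']
          push_cast
          ring
        rw [e, rotheSeries_zero, mul_one]
        exact coeff_even_boundarySeries hW q
    | succ m ihm =>
      have hle := stairAbscissa_le_succ b a l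
      rw [← add_assoc, underCount_succ_succ (by omega), Nat.cast_add, ihm, ihl _ (by omega)]
      have e₁ : ((s + m + 1 : ℕ) : ℚ) + 1 - ((a : ℚ) + b) / 2 * (l + 1 : ℕ) =
          ((s + m : ℕ) : ℚ) + 1 - ((a : ℚ) + b) / 2 * (l + 1 : ℕ) + 1 := by
        push_cast
        ring
      have e₂ : ((s + m + 1 : ℕ) : ℚ) + 1 - ((a : ℚ) + b) / 2 * l =
          ((s + m : ℕ) : ℚ) + 1 - ((a : ℚ) + b) / 2 * (l + 1 : ℕ) + (((a : ℚ) + b) / 2 + 1) := by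
        push_cast
        ring
      rw [e₁, e₂, rotheSeries_add_one, mul_add, mul_left_comm, map_add, coeff_succ_X_mul]

theorem Mq_eq_two_mul_coeff {a b : ℕ} (hab : a < b) (i : ℕ) :
    Mq a b (a + b) i = 2 * PowerSeries.coeff (2 * i + 1)
      (rotheSeries (((a : ℚ) + b) / 2 + 1) (((b : ℚ) - a) / 2)) := by
  have e : ((b : ℚ) - a) / 2 + (((a : ℚ) + b) / 2 + 1) * (2 * i + 1 : ℕ) - (2 * i + 1 : ℕ) =
      ((a + b : ℕ) : ℚ) * i + b := by
    push_cast
    ring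
  have hb : (0 : ℚ) < b := by exact_mod_cast (by omega : 0 < b)
  rw [coeff_rotheSeries, eval_rothePoly_eq_choose (K := (a + b + 2) * i + b), e, Mq]
  · ring
  · push_cast
    ring
  · rw [e]
    positivity

theorem Nq_eq_coeff {a b : ℕ} (hab : a < b) (n : ℕ) :
    Nq a b (a + b) n = PowerSeries.coeff (2 * n)
      (rotheSeries (((a : ℚ) + b) / 2 + 1) ((b : ℚ) - a)) := by
  have e : ((b : ℚ) - a) + (((a : ℚ) + b) / 2 + 1) * (2 * n : ℕ) - (2 * n : ℕ) =
      ((a + b : ℕ) : ℚ) * n + b - a := by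
    push_cast
    ring
  obtain ⟨d, rfl⟩ := Nat.exists_eq_add_of_lt hab
  rw [coeff_rotheSeries,
    eval_rothePoly_eq_choose (K := (a + (a + d + 1) + 2) * n + (a + d + 1) - a - 1), e, Nq]
  · rw [show (a + (a + d + 1) + 2) * n + (a + d + 1) - a - 1 =
      (a + (a + d + 1) + 2) * n + d by omega]
    push_cast
    ring
  · rw [e]
    push_cast
    rw [add_sub_assoc]
    have : ((a : ℚ) + d + 1) - a = d + 1 := by ring
    rw [this]
    positivity

theorem stmt11 (a b : ℕ) (hab : a < b) (c : ℕ) (hc : c = a + b) (n : ℕ) :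
    (Nat.card {P : List Bool //
        P.count false = c * n + b - a - 1 ∧ P.count true = 2 * n ∧
        UnderPeriodic b a P} : ℚ) =
      Nq a b c n - (1 / 2) * ∑ i ∈ Finset.range n, Mq a b c i * Mq a b c (n - 1 - i) := by
  subst hc
  have hW := constantCoeff_rotheSeries (((a : ℚ) + b) / 2 + 1) (((b : ℚ) - a) / 2)
  have hsq : rotheSeries (((a : ℚ) + b) / 2 + 1) (((b : ℚ) - a) / 2) ^ 2 =
      rotheSeries (((a : ℚ) + b) / 2 + 1) ((b : ℚ) - a) := by
    rw [sq, ← rotheSeries_add, add_halves]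
  have hk : stairAbscissa b a (2 * n) ≤ (a + b) * n + b - a - 1 + 1 := by
    rw [stairAbscissa_two_mul, mul_comm, add_comm b]
    omega
  have hcast : (((a + b) * n + b - a - 1 : ℕ) : ℚ) + 1 - ((a : ℚ) + b) / 2 * (2 * n : ℕ) =
      b - a := by
    obtain ⟨d, rfl⟩ := Nat.exists_eq_add_of_lt hab
    rw [show (a + (a + d + 1)) * n + (a + d + 1) - a - 1 = (a + (a + d + 1)) * n + d by omega]
    push_cast
    ring
  have hcount := underCount_eq_coeff hab (2 * n) _ hk
  rw [hcast, ← hsq, coeff_even_boundarySeries_mul_sq hW, hsq, ← Nq_eq_coeff hab,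
    coeff_even_sub_rescale_neg_one_sq] at hcount
  simp only [← Mq_eq_two_mul_coeff hab] at hcount
  exact hcount
end

section
/- Let n ≥ 1 and let C_j denote the j-th Catalan number. The number of lattice paths from (0,0) that lie weakly under the boundary word U(R²U²)ⁿR and have terminus (2n, 2n) equals 2^{2n+1}·C_n − C_{2n+1}; the same count holds for terminus (2n, 2n−1) and for terminus (2n, 2n+1). -/
/-- A lattice path is a list of steps: `false` = R-step `(1,0)`, `true` = U-step `(0,1)`,
starting at the origin.  `UnderWord B P` says `P` lies weakly under the boundary word `B`:
for each `y`, the number of R-steps of `P` preceding its `y`-th U-step is at least the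
number of R-steps of `B` preceding the `y`-th U-step of `B` (expressed via the prefixes
ending just before those U-steps). -/
def UnderWord (B P : List Bool) : Prop :=
  ∀ pB rB pP rP : List Bool, B = pB ++ true :: rB → P = pP ++ true :: rP →
    pP.count true = pB.count true → pB.count false ≤ pP.count false

/-- The boundary word `U(R²U²)ⁿR`. -/
def bdryURRUUnR (n : ℕ) : List Bool :=
  [true] ++ (List.replicate n [false, false, true, true]).flatten ++ [false]

/-- `P` stays weakly under the periodic boundary whose `y`-th U-step is preceded by
`2 * (y / 2)` R-steps. -/
def UnderStaircase (P : List Bool) : Prop :=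
  ∀ p r : List Bool, P = p ++ true :: r → 2 * ((p.count true + 1) / 2) ≤ p.count false

theorem underStaircase_nil : UnderStaircase [] := by
  intro p r h
  simp at h

theorem underStaircase_snoc_false (P : List Bool) :
    UnderStaircase (P ++ [false]) ↔ UnderStaircase P := by
  constructor
  · intro h p r hP
    exact h p (r ++ [false]) (by simp [hP])
  · intro h p r hP
    rcases List.eq_nil_or_concat r with rfl | ⟨r', b, rfl⟩
    · have := congrArg List.getLast? hP
      simp at this
    · rw [List.concat_eq_append, ← List.cons_append, ← List.append_assoc] at hP
      exact h p r' (List.append_inj_left' hP rfl)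

theorem underStaircase_snoc_true (P : List Bool) :
    UnderStaircase (P ++ [true]) ↔
      UnderStaircase P ∧ 2 * ((P.count true + 1) / 2) ≤ P.count false := by
  constructor
  · intro h
    exact ⟨fun p r hP => h p (r ++ [true]) (by simp [hP]), h P [] rfl⟩
  · rintro ⟨h, h'⟩ p r hP
    rcases List.eq_nil_or_concat r with rfl | ⟨r', b, rfl⟩
    · rw [← List.append_inj_left' hP rfl]
      exact h'
    · rw [List.concat_eq_append, ← List.cons_append, ← List.append_assoc] at hP
      exact h p r' (List.append_inj_left' hP rfl)

theorem count_false_of_flatten_split (n : ℕ) (p r : List Bool)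
    (h : (List.replicate n [false, false, true, true]).flatten ++ [false] = p ++ true :: r) :
    p.count false = 2 * (p.count true / 2 + 1) := by
  induction n generalizing p with
  | zero =>
    rcases p with _ | ⟨a, _ | ⟨b, p⟩⟩ <;> simp at h
  | succ n ih =>
    rw [List.replicate_succ, List.flatten_cons] at h
    rcases p with _ | ⟨a, _ | ⟨b, _ | ⟨c, _ | ⟨d, p⟩⟩⟩⟩
    · simp at h
    · simp at h
    · simp at h
      obtain ⟨rfl, rfl, -⟩ := h
      rfl
    · simp at h
      obtain ⟨rfl, rfl, rfl, -⟩ := h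
      rfl
    · simp only [List.cons_append, List.nil_append, List.cons.injEq] at h
      obtain ⟨rfl, rfl, rfl, rfl, h⟩ := h
      have := ih p h
      simp
      omega

theorem exists_flatten_split (n y : ℕ) (hy : y < 2 * n) :
    ∃ p r : List Bool,
      (List.replicate n [false, false, true, true]).flatten ++ [false] = p ++ true :: r ∧
        p.count true = y := by
  induction n generalizing y with
  | zero => omega
  | succ n ih =>
    rw [List.replicate_succ, List.flatten_cons]
    match y with
    | 0 => exact ⟨[false, false], _, rfl, rfl⟩
    | 1 => exact ⟨[false, false, true], _, rfl, rfl⟩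
    | y + 2 =>
      obtain ⟨p, r, h, hp⟩ := ih y (by omega)
      exact ⟨false :: false :: true :: true :: p, r, by simp [h], by simp [hp]⟩

theorem underWord_bdry_iff (n : ℕ) (P : List Bool) (hP : P.count true ≤ 2 * n + 1) :
    UnderWord (bdryURRUUnR n) P ↔ UnderStaircase P := by
  constructor
  · intro h p r hp
    have hlt : p.count true < 2 * n + 1 := by
      rw [hp] at hP
      simp at hP
      omega
    rcases Nat.eq_zero_or_pos (p.count true) with h0 | h0
    · simp [h0]
    · obtain ⟨p', r', hB, hp'⟩ := exists_flatten_split n (p.count true - 1) (by omega)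
      have hle := h (true :: p') r' p r (by simp [bdryURRUUnR, hB]) hp (by simp; omega)
      have hc := count_false_of_flatten_split n p' r' hB
      simp at hle
      omega
  · intro h pB rB pP rP hB hp hc
    have hle := h pP rP hp
    rcases pB with _ | ⟨a, pB⟩
    · simp
    · simp only [bdryURRUUnR, List.cons_append, List.nil_append, List.cons.injEq] at hB
      obtain ⟨rfl, hB⟩ := hB
      have := count_false_of_flatten_split n pB rB hB
      simp at hc ⊢
      omega

/-- The paths with terminus `(k, l)` that stay under the periodic staircase. -/
def staircasePaths (k l : ℕ) : Set (List Bool) :=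
  {P | P.count false = k ∧ P.count true = l ∧ UnderStaircase P}

theorem staircasePaths_finite (k l : ℕ) : (staircasePaths k l).Finite := by
  refine (List.finite_length_eq Bool (k + l)).subset ?_
  rintro P ⟨h1, h2, -⟩
  have := List.count_false_add_count_true P
  simp only [Set.mem_ofPred_eq]
  omega

/-- The number of paths with terminus `(k, l)` that stay under the periodic staircase. -/
noncomputable def staircaseCount (k l : ℕ) : ℕ := (staircasePaths k l).ncard

theorem snoc_injective (b : Bool) : Function.Injective fun P : List Bool => P ++ [b] :=
  fun _ _ h => List.append_inj_left' h rfl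

theorem mem_staircasePaths_snoc_false (P : List Bool) (k l : ℕ) :
    P ++ [false] ∈ staircasePaths (k + 1) l ↔ P ∈ staircasePaths k l := by
  simp [staircasePaths, underStaircase_snoc_false]

theorem staircaseCount_eq_zero {k l : ℕ} (h : k < 2 * (l / 2)) : staircaseCount k l = 0 := by
  have key : ∀ P : List Bool, UnderStaircase P → 2 * (P.count true / 2) ≤ P.count false := by
    intro P
    induction P using List.reverseRecOn with
    | nil => simp
    | append_singleton P b ih =>
      cases b
      · rw [underStaircase_snoc_false]
        intro hP
        have := ih hP
        simp
        omega
      · rw [underStaircase_snoc_true]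
        rintro ⟨-, hP⟩
        simpa using hP
  have : staircasePaths k l = ∅ := by
    ext P
    simp only [staircasePaths, Set.mem_ofPred_eq, Set.mem_empty_iff_false, iff_false]
    rintro ⟨h1, h2, h3⟩
    have := key P h3
    subst h1 h2
    omega
  simp [staircaseCount, this]

theorem staircaseCount_zero_zero : staircaseCount 0 0 = 1 := by
  have : staircasePaths 0 0 = {[]} := by
    ext P
    simp only [staircasePaths, Set.mem_ofPred_eq, Set.mem_singleton_iff]
    constructor
    · rintro ⟨h1, h2, -⟩
      have := List.count_false_add_count_true P
      exact List.eq_nil_of_length_eq_zero (by omega)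
    · rintro rfl
      exact ⟨rfl, rfl, underStaircase_nil⟩
  simp [staircaseCount, this]

theorem staircaseCount_zero_right (k : ℕ) : staircaseCount k 0 = 1 := by
  induction k with
  | zero => exact staircaseCount_zero_zero
  | succ k ih =>
    have : staircasePaths (k + 1) 0 = (fun P => P ++ [false]) '' staircasePaths k 0 := by
      ext P
      constructor
      · intro hP
        rcases List.eq_nil_or_concat P with rfl | ⟨Q, b, rfl⟩
        · simp [staircasePaths] at hP
        · cases b
          · rw [List.concat_eq_append, mem_staircasePaths_snoc_false] at hP
            exact ⟨Q, hP, by simp⟩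
          · simp [staircasePaths] at hP
      · rintro ⟨Q, hQ, rfl⟩
        exact (mem_staircasePaths_snoc_false _ _ _).2 hQ
    rw [staircaseCount, this, Set.ncard_image_of_injective _ (snoc_injective false)]
    exact ih

theorem mem_staircasePaths_snoc_true (P : List Bool) {k l : ℕ} (h : 2 * ((l + 1) / 2) ≤ k) :
    P ++ [true] ∈ staircasePaths k (l + 1) ↔ P ∈ staircasePaths k l := by
  simp only [staircasePaths, Set.mem_ofPred_eq, underStaircase_snoc_true, List.count_append,
    List.count_singleton]
  constructor
  · rintro ⟨h1, h2, h3, -⟩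
    exact ⟨by simpa using h1, by simpa using h2, h3⟩
  · rintro ⟨h1, h2, h3⟩
    exact ⟨by simpa using h1, by simpa using h2, h3, by rwa [h1, h2]⟩

theorem staircaseCount_zero_one : staircaseCount 0 1 = 1 := by
  have : staircasePaths 0 1 = (fun P => P ++ [true]) '' staircasePaths 0 0 := by
    ext P
    constructor
    · intro hP
      rcases List.eq_nil_or_concat P with rfl | ⟨Q, b, rfl⟩
      · simp [staircasePaths] at hP
      · cases b
        · simp [staircasePaths] at hP
        · rw [List.concat_eq_append, mem_staircasePaths_snoc_true _ (by norm_num)] at hP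
          exact ⟨Q, hP, by simp⟩
    · rintro ⟨Q, hQ, rfl⟩
      exact (mem_staircasePaths_snoc_true _ (by norm_num)).2 hQ
  rw [staircaseCount, this, Set.ncard_image_of_injective _ (snoc_injective true)]
  exact staircaseCount_zero_zero

theorem staircaseCount_succ_succ {k l : ℕ} (h : 2 * ((l + 1) / 2) ≤ k + 1) :
    staircaseCount (k + 1) (l + 1) = staircaseCount k (l + 1) + staircaseCount (k + 1) l := by
  have hu : staircasePaths (k + 1) (l + 1) =
      (fun P => P ++ [false]) '' staircasePaths k (l + 1) ∪
        (fun P => P ++ [true]) '' staircasePaths (k + 1) l := by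
    ext P
    constructor
    · intro hP
      rcases List.eq_nil_or_concat P with rfl | ⟨Q, b, rfl⟩
      · simp [staircasePaths] at hP
      · cases b
        · rw [List.concat_eq_append, mem_staircasePaths_snoc_false] at hP
          exact Or.inl ⟨Q, hP, by simp⟩
        · rw [List.concat_eq_append, mem_staircasePaths_snoc_true _ h] at hP
          exact Or.inr ⟨Q, hP, by simp⟩
    · rintro (⟨Q, hQ, rfl⟩ | ⟨Q, hQ, rfl⟩)
      · exact (mem_staircasePaths_snoc_false _ _ _).2 hQ
      · exact (mem_staircasePaths_snoc_true _ h).2 hQ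
  have hd : Disjoint ((fun P => P ++ [false]) '' staircasePaths k (l + 1))
      ((fun P => P ++ [true]) '' staircasePaths (k + 1) l) := by
    rw [Set.disjoint_left]
    rintro _ ⟨Q, -, rfl⟩ ⟨Q', -, hQ⟩
    have := congrArg List.getLast? hQ
    simp at this
  rw [staircaseCount, hu, Set.ncard_union_eq hd ((staircasePaths_finite _ _).image _)
    ((staircasePaths_finite _ _).image _), Set.ncard_image_of_injective _ (snoc_injective _),
    Set.ncard_image_of_injective _ (snoc_injective _), staircaseCount, staircaseCount]

/-- The ballot number `binom (k + l) l - binom (k + l) (l - 1)`. -/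
def ballotNumber (k : ℕ) : ℕ → ℤ
  | 0 => 1
  | l + 1 => (k + l + 1).choose (l + 1) - (k + l + 1).choose l

theorem ballotNumber_succ_succ (k l : ℕ) :
    ballotNumber (k + 1) (l + 1) = ballotNumber k (l + 1) + ballotNumber (k + 1) l := by
  cases l with
  | zero => simp [ballotNumber]
  | succ l =>
    simp only [ballotNumber]
    rw [show k + 1 + (l + 1) + 1 = (k + l + 2) + 1 by ring,
      show k + (l + 1) + 1 = k + l + 2 by ring, show k + 1 + l + 1 = k + l + 2 by ring,
      Nat.choose_succ_succ (k + l + 2) (l + 1), Nat.choose_succ_succ (k + l + 2) l]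
    push_cast
    ring

theorem ballotNumber_self_succ (k : ℕ) : ballotNumber k (k + 1) = 0 := by
  have := Nat.choose_symm_of_eq_add (show k + k + 1 = (k + 1) + k by ring)
  simp [ballotNumber, this]

theorem ballotNumber_self (k : ℕ) : ballotNumber k k = catalan k := by
  cases k with
  | zero => simp [ballotNumber]
  | succ k =>
    have h1 := succ_mul_catalan_eq_centralBinom (k + 1)
    have h2 := Nat.choose_succ_right_eq (2 * (k + 1)) k
    rw [Nat.centralBinom] at h1
    rw [show 2 * (k + 1) - k = k + 2 by omega] at h2
    simp only [ballotNumber]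
    rw [show k + 1 + k + 1 = 2 * (k + 1) by ring]
    zify at h1 h2
    have : ((k : ℤ) + 2) ≠ 0 := by positivity
    apply mul_left_cancel₀ this
    linear_combination h2 - h1

/-- The number of paths to `(k, l)` staying weakly below the diagonal from `(2i + 1, 2i + 1)`. -/
def shiftedBallot (i k l : ℕ) : ℤ :=
  if 2 * i + 1 ≤ l then ballotNumber (k - (2 * i + 1)) (l - (2 * i + 1)) else 0

theorem shiftedBallot_succ_succ (i k l : ℕ) (h : l < k) :
    shiftedBallot i (k + 1) (l + 1) = shiftedBallot i k (l + 1) + shiftedBallot i (k + 1) l := by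
  unfold shiftedBallot
  rcases lt_trichotomy (2 * i) l with h1 | h1 | h1
  · rw [if_pos (by omega), if_pos (by omega), if_pos (by omega)]
    have := ballotNumber_succ_succ (k - (2 * i + 1)) (l - (2 * i + 1))
    rwa [show k - (2 * i + 1) + 1 = k + 1 - (2 * i + 1) by omega,
      show l - (2 * i + 1) + 1 = l + 1 - (2 * i + 1) by omega] at this
  · simp [h1, ballotNumber]
  · rw [if_neg (by omega), if_neg (by omega), if_neg (by omega)]
    rfl

theorem shiftedBallot_diag (i l : ℕ) :
    shiftedBallot i (l + 1) (l + 1) =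
      (if 2 * i = l then 1 else 0) + shiftedBallot i (l + 1) l := by
  unfold shiftedBallot
  rcases lt_trichotomy (2 * i) l with h1 | h1 | h1
  · rw [if_pos (by omega), if_neg (by omega), if_pos (by omega), zero_add]
    obtain ⟨m, rfl⟩ : ∃ m, l = m + 2 * i + 1 := ⟨l - (2 * i + 1), by omega⟩
    have := ballotNumber_succ_succ m m
    rw [ballotNumber_self_succ, zero_add] at this
    convert this using 2 <;> omega
  · simp [h1, ballotNumber]
  · rw [if_neg (by omega), if_neg (by omega), if_neg (by omega)]
    rfl

/-- Decomposition of a path at its last visit to the line `l = k + 1`. -/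
theorem staircaseCount_eq_sum (M k l : ℕ) (hlk : l ≤ k) (hM : l ≤ 2 * M) :
    (staircaseCount k l : ℤ) = ballotNumber k l +
      ∑ i ∈ Finset.range M, staircaseCount (2 * i) (2 * i + 1) * shiftedBallot i k l := by
  induction l generalizing k with
  | zero => simp [staircaseCount_zero_right, ballotNumber, shiftedBallot]
  | succ l ih =>
    induction k, hlk using Nat.le_induction with
    | base =>
      rw [staircaseCount_succ_succ (by omega), Nat.cast_add, ih (l + 1) (by omega) (by omega),
        ballotNumber_succ_succ, ballotNumber_self_succ]
      simp only [shiftedBallot_diag, mul_add, Finset.sum_add_distrib]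
      have : (∑ i ∈ Finset.range M, (staircaseCount (2 * i) (2 * i + 1) : ℤ) *
          (if 2 * i = l then 1 else 0)) = staircaseCount l (l + 1) := by
        rcases Nat.even_or_odd' l with ⟨m, rfl | rfl⟩
        · rw [Finset.sum_eq_single m]
          · simp
          · intro b _ hb
            rw [if_neg (by omega), mul_zero]
          · intro hm
            rw [Finset.mem_range] at hm
            omega
        · rw [staircaseCount_eq_zero (by omega), Finset.sum_eq_zero]
          · simp
          · intro b _
            rw [if_neg (by omega), mul_zero]
      rw [this]
      ring
    | succ k hk ihk =>
      rw [staircaseCount_succ_succ (by omega), Nat.cast_add, ih (k + 1) (by omega) (by omega),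
        ihk, ballotNumber_succ_succ]
      simp only [shiftedBallot_succ_succ _ k l (by omega), mul_add, Finset.sum_add_distrib]
      ring

theorem staircaseCount_top (n : ℕ) :
    staircaseCount (2 * n) (2 * n + 1) = staircaseCount (2 * n) (2 * n) := by
  cases n with
  | zero => rw [staircaseCount_zero_one, staircaseCount_zero_zero]
  | succ n =>
    rw [show 2 * (n + 1) = 2 * n + 1 + 1 by ring, staircaseCount_succ_succ (by omega),
      staircaseCount_eq_zero (by omega), zero_add]

theorem staircaseCount_below {n : ℕ} (hn : 1 ≤ n) :
    staircaseCount (2 * n) (2 * n - 1) = staircaseCount (2 * n) (2 * n) := by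
  obtain ⟨m, rfl⟩ : ∃ m, n = m + 1 := ⟨n - 1, by omega⟩
  rw [show 2 * (m + 1) = 2 * m + 1 + 1 by ring, Nat.add_sub_cancel,
    staircaseCount_succ_succ (k := 2 * m + 1) (l := 2 * m + 1) (by omega),
    staircaseCount_eq_zero (k := 2 * m + 1) (by omega), zero_add]

theorem staircaseCount_diag_recurrence (n : ℕ) :
    (staircaseCount (2 * n) (2 * n) : ℤ) = catalan (2 * n) +
      ∑ i ∈ Finset.range n,
        (staircaseCount (2 * i) (2 * i) : ℤ) * catalan (2 * (n - 1 - i) + 1) := by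
  rw [staircaseCount_eq_sum n (2 * n) (2 * n) le_rfl le_rfl, ballotNumber_self]
  congr 1
  refine Finset.sum_congr rfl fun i hi => ?_
  rw [Finset.mem_range] at hi
  rw [staircaseCount_top, shiftedBallot, if_pos (by omega), ballotNumber_self,
    show 2 * n - (2 * i + 1) = 2 * (n - 1 - i) + 1 by omega]

section GeneratingFunctions

open PowerSeries

/-- Generating function of the even-indexed Catalan numbers. -/
noncomputable def evenCatalanSeries : ℤ⟦X⟧ := PowerSeries.mk fun n => (catalan (2 * n) : ℤ)

/-- Generating function of the odd-indexed Catalan numbers. -/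
noncomputable def oddCatalanSeries : ℤ⟦X⟧ := PowerSeries.mk fun n => (catalan (2 * n + 1) : ℤ)

theorem sum_range_two_mul_parity (f : ℕ → ℤ) (n : ℕ) :
    ∑ i ∈ Finset.range (2 * n), f i =
      ∑ i ∈ Finset.range n, f (2 * i) + ∑ i ∈ Finset.range n, f (2 * i + 1) := by
  induction n with
  | zero => simp
  | succ n ih =>
    rw [show 2 * (n + 1) = 2 * n + 1 + 1 by ring]
    simp only [Finset.sum_range_succ, ih]
    ring

theorem catalan_succ_range (n : ℕ) :
    (catalan (n + 1) : ℤ) = ∑ i ∈ Finset.range (n + 1), (catalan i : ℤ) * catalan (n - i) := by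
  rw [catalan_succ, Finset.sum_range]
  push_cast
  rfl

theorem coeff_mul_range (f g : ℤ⟦X⟧) (n : ℕ) :
    coeff n (f * g) = ∑ i ∈ Finset.range (n + 1), coeff i f * coeff (n - i) g := by
  rw [coeff_mul, Finset.Nat.sum_antidiagonal_eq_sum_range_succ fun i j => coeff i f * coeff j g]

theorem evenCatalanSeries_eq :
    evenCatalanSeries = 1 + 2 * (X * (evenCatalanSeries * oddCatalanSeries)) := by
  ext n
  cases n with
  | zero => simp [evenCatalanSeries]
  | succ n =>
    have h2 : (2 : ℤ⟦X⟧) = C 2 := by simp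
    rw [map_add, h2, coeff_C_mul, coeff_succ_X_mul, coeff_one, if_neg (by omega), zero_add, two_mul]
    nth_rw 2 [mul_comm evenCatalanSeries]
    simp only [coeff_mul_range]
    simp only [evenCatalanSeries, oddCatalanSeries, coeff_mk]
    rw [show 2 * (n + 1) = 2 * n + 1 + 1 by ring, catalan_succ_range,
      show 2 * n + 1 + 1 = 2 * (n + 1) by ring, sum_range_two_mul_parity]
    congr 1 <;>
    · refine Finset.sum_congr rfl fun i hi => ?_
      rw [Finset.mem_range] at hi
      congr 3
      omega

theorem oddCatalanSeries_eq :
    oddCatalanSeries = evenCatalanSeries ^ 2 + X * oddCatalanSeries ^ 2 := by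
  ext n
  rw [map_add, sq, sq]
  cases n with
  | zero => simp [evenCatalanSeries, oddCatalanSeries]
  | succ n =>
    rw [coeff_succ_X_mul]
    simp only [coeff_mul_range]
    simp only [evenCatalanSeries, oddCatalanSeries, coeff_mk]
    rw [catalan_succ_range, Finset.sum_range_succ, sum_range_two_mul_parity,
      Finset.sum_range_succ _ (n + 1), add_right_comm]
    congr 1
    · congr 1
      · refine Finset.sum_congr rfl fun i hi => ?_
        rw [Nat.mul_sub]
      · simp
    · refine Finset.sum_congr rfl fun i hi => ?_
      rw [Finset.mem_range] at hi
      congr 3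
      omega

theorem evenCatalanSeries_sq :
    evenCatalanSeries ^ 2 = PowerSeries.mk fun n => (4 ^ n * catalan n : ℤ) := by
  set G : ℤ⟦X⟧ := PowerSeries.mk fun n => (4 ^ n * catalan n : ℤ) with hG
  have hE := evenCatalanSeries_eq
  have hO := oddCatalanSeries_eq
  set E := evenCatalanSeries
  set O := oddCatalanSeries
  have hE4 : E ^ 2 = 1 + 4 * X * (E ^ 2) ^ 2 := by
    linear_combination (E + 1 - 2 * (X * (E * O))) * hE + 4 * X * E ^ 2 * hO
  have hG4 : G = 1 + 4 * X * G ^ 2 := by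
    ext n
    rw [mul_assoc, map_add, show (4 : ℤ⟦X⟧) = C 4 by simp, coeff_C_mul, sq]
    cases n with
    | zero => simp [hG]
    | succ n =>
      rw [coeff_succ_X_mul, coeff_mul_range, coeff_one, if_neg (by omega), zero_add]
      simp only [hG, coeff_mk]
      rw [catalan_succ_range, Finset.mul_sum, Finset.mul_sum]
      refine Finset.sum_congr rfl fun i hi => ?_
      rw [Finset.mem_range] at hi
      obtain ⟨j, rfl⟩ : ∃ j, n = i + j := ⟨n - i, by omega⟩
      rw [Nat.add_sub_cancel_left]
      ring
  have hprod : (E ^ 2 - G) * (1 - 4 * X * (E ^ 2 + G)) = 0 := by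
    linear_combination hE4 - hG4
  rcases mul_eq_zero.1 hprod with h | h
  · exact sub_eq_zero.1 h
  · have := congrArg constantCoeff h
    simp at this

theorem staircaseCount_diag (n : ℕ) :
    (staircaseCount (2 * n) (2 * n) : ℤ) = 2 ^ (2 * n + 1) * catalan n - catalan (2 * n + 1) := by
  set V : ℤ⟦X⟧ := PowerSeries.mk fun n => (staircaseCount (2 * n) (2 * n) : ℤ) with hV
  have hrec : V = evenCatalanSeries + X * (V * oddCatalanSeries) := by
    ext n
    rw [map_add]
    cases n with
    | zero => simp [hV, evenCatalanSeries, staircaseCount_zero_zero]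
    | succ n =>
      rw [coeff_succ_X_mul, coeff_mul_range]
      simp only [hV, evenCatalanSeries, oddCatalanSeries, coeff_mk]
      exact staircaseCount_diag_recurrence (n + 1)
  have hprod : (V - (2 * evenCatalanSeries ^ 2 - oddCatalanSeries)) *
      (1 - X * oddCatalanSeries) = 0 := by
    linear_combination hrec + oddCatalanSeries_eq - evenCatalanSeries * evenCatalanSeries_eq
  rcases mul_eq_zero.1 hprod with h | h
  · have := congrArg (coeff n) (sub_eq_zero.1 h)
    rw [evenCatalanSeries_sq, map_sub, show (2 : ℤ⟦X⟧) = C 2 by simp, coeff_C_mul] at this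
    simp only [hV, oddCatalanSeries, coeff_mk] at this
    rw [this, pow_succ, pow_mul]
    norm_num
    ring
  · have := congrArg constantCoeff h
    simp at this

end GeneratingFunctions

theorem card_underWord_bdry (n k l : ℕ) (hl : l ≤ 2 * n + 1) :
    Nat.card {P : List Bool //
      P.count false = k ∧ P.count true = l ∧ UnderWord (bdryURRUUnR n) P} =
      staircaseCount k l := by
  rw [staircaseCount, ← Nat.card_coe_set_eq]
  refine Nat.card_congr (Equiv.subtypeEquivRight fun P => ?_)
  refine and_congr_right fun _ => and_congr_right fun h => underWord_bdry_iff n P (by omega)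

theorem stmt14 (n : ℕ) (hn : 1 ≤ n) :
    ((Nat.card {P : List Bool //
        P.count false = 2 * n ∧ P.count true = 2 * n ∧
        UnderWord (bdryURRUUnR n) P} : ℕ) : ℤ) =
      2 ^ (2 * n + 1) * catalan n - catalan (2 * n + 1) ∧
    ((Nat.card {P : List Bool //
        P.count false = 2 * n ∧ P.count true = 2 * n - 1 ∧
        UnderWord (bdryURRUUnR n) P} : ℕ) : ℤ) =
      2 ^ (2 * n + 1) * catalan n - catalan (2 * n + 1) ∧
    ((Nat.card {P : List Bool //
        P.count false = 2 * n ∧ P.count true = 2 * n + 1 ∧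
        UnderWord (bdryURRUUnR n) P} : ℕ) : ℤ) =
      2 ^ (2 * n + 1) * catalan n - catalan (2 * n + 1) := by
  rw [card_underWord_bdry _ _ _ (by omega), card_underWord_bdry _ _ _ (by omega),
    card_underWord_bdry _ _ _ (by omega), staircaseCount_below hn, staircaseCount_top,
    staircaseCount_diag]
  exact ⟨rfl, rfl, rfl⟩
end

section
/- Let C_j denote the j-th Catalan number. For every n ≥ 0, Σ_{i=0}^{n−1} C_{2i+1}·C_{2n−(2i+1)} = C_{2n+1} − 2^{2n}·C_n. -/
theorem sum_range_two_mul {M : Type*} [AddCommMonoid M] (f : ℕ → M) (n : ℕ) :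
    ∑ i ∈ Finset.range (2 * n), f i =
      ∑ i ∈ Finset.range n, f (2 * i) + ∑ i ∈ Finset.range n, f (2 * i + 1) := by
  induction n with
  | zero => simp
  | succ n ih =>
    rw [mul_add, mul_one, Finset.sum_range_succ, Finset.sum_range_succ, ih,
      Finset.sum_range_succ, Finset.sum_range_succ]
    abel

theorem catalan_succ_eq_sum_range (n : ℕ) :
    catalan (n + 1) = ∑ i ∈ Finset.range (n + 1), catalan i * catalan (n - i) := by
  rw [catalan_succ', Finset.Nat.sum_antidiagonal_eq_sum_range_succ_mk]

theorem catalan_two_mul_add_one (n : ℕ) :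
    catalan (2 * n + 1) =
      ∑ i ∈ Finset.range (n + 1), catalan (2 * i) * catalan (2 * (n - i)) +
        ∑ i ∈ Finset.range n, catalan (2 * i + 1) * catalan (2 * n - (2 * i + 1)) := by
  rw [catalan_succ_eq_sum_range, Finset.sum_range_succ, sum_range_two_mul, Finset.sum_range_succ]
  simp only [Nat.mul_sub]
  abel

theorem catalan_two_mul_add_two (n : ℕ) :
    catalan (2 * (n + 1)) =
      ∑ i ∈ Finset.range (n + 1), catalan (2 * i) * catalan (2 * (n - i) + 1) +
        ∑ i ∈ Finset.range (n + 1), catalan (2 * i + 1) * catalan (2 * (n - i)) := by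
  rw [show 2 * (n + 1) = (2 * n + 1) + 1 by ring, catalan_succ_eq_sum_range,
    show 2 * n + 1 + 1 = 2 * (n + 1) by ring, sum_range_two_mul]
  congr 1 <;> refine Finset.sum_congr rfl fun i hi => ?_
  all_goals
    have := Finset.mem_range.mp hi
    congr 2
    omega

namespace PowerSeries

/-- The generating function of the Catalan numbers of even index. -/
noncomputable def evenCatalanSeries : PowerSeries ℤ := mk fun n => (catalan (2 * n) : ℤ)

/-- The generating function of the Catalan numbers of odd index. -/
noncomputable def oddCatalanSeries : PowerSeries ℤ := mk fun n => (catalan (2 * n + 1) : ℤ)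

theorem evenCatalanSeries_eq :
    evenCatalanSeries = 1 + X * (2 * (evenCatalanSeries * oddCatalanSeries)) := by
  have h : evenCatalanSeries =
      1 + X * (evenCatalanSeries * oddCatalanSeries + oddCatalanSeries * evenCatalanSeries) := by
    ext n
    cases n with
    | zero => simp [evenCatalanSeries]
    | succ n =>
      rw [map_add, coeff_succ_X_mul]
      simp only [map_add, coeff_mul, coeff_one,
        Finset.Nat.sum_antidiagonal_eq_sum_range_succ_mk, evenCatalanSeries, oddCatalanSeries,
        coeff_mk, catalan_two_mul_add_two]
      simp
  linear_combination h

theorem oddCatalanSeries_eq :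
    oddCatalanSeries = evenCatalanSeries ^ 2 + X * oddCatalanSeries ^ 2 := by
  ext n
  cases n with
  | zero => simp [evenCatalanSeries, oddCatalanSeries, sq]
  | succ n =>
    rw [map_add, coeff_succ_X_mul]
    simp only [sq, coeff_mul,
      Finset.Nat.sum_antidiagonal_eq_sum_range_succ_mk, evenCatalanSeries, oddCatalanSeries,
      coeff_mk, catalan_two_mul_add_one (n + 1)]
    push_cast
    congr 1
    refine Finset.sum_congr rfl fun i hi => ?_
    have := Finset.mem_range.mp hi
    rw [show 2 * (n + 1) - (2 * i + 1) = 2 * (n - i) + 1 by omega]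

theorem evenCatalanSeries_sq_eq :
    evenCatalanSeries ^ 2 = 1 + 4 * X * (evenCatalanSeries ^ 2) ^ 2 := by
  linear_combination (evenCatalanSeries + 1 -
    2 * X * evenCatalanSeries * oddCatalanSeries) * evenCatalanSeries_eq +
    4 * X * evenCatalanSeries ^ 2 * oddCatalanSeries_eq

theorem eq_of_eq_one_add_mul_X_mul_sq {R : Type*} [CommRing R] [IsDomain R] {r : PowerSeries R}
    {f g : PowerSeries R} (hf : f = 1 + r * X * f ^ 2) (hg : g = 1 + r * X * g ^ 2) : f = g := by
  have h : (f - g) * (1 - X * (r * (f + g))) = 0 := by linear_combination hf - hg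
  refine sub_eq_zero.mp ((mul_eq_zero.mp h).resolve_right fun h0 => ?_)
  simpa using congrArg constantCoeff h0

theorem evenCatalanSeries_sq :
    evenCatalanSeries ^ 2 = rescale 4 (catalanSeries.map (Nat.castRingHom ℤ)) := by
  refine eq_of_eq_one_add_mul_X_mul_sq evenCatalanSeries_sq_eq ?_
  have h := congrArg (fun f => rescale (4 : ℤ) (f.map (Nat.castRingHom ℤ)))
    catalanSeries_sq_mul_X_add_one
  simp only [map_add, map_mul, map_pow, map_one, map_X, rescale_X] at h
  rw [show (C (4 : ℤ) : PowerSeries ℤ) = 4 from map_ofNat C 4] at h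
  linear_combination -h

end PowerSeries

theorem sum_catalan_two_mul_mul_catalan_two_mul (n : ℕ) :
    (∑ i ∈ Finset.range (n + 1), (catalan (2 * i) * catalan (2 * (n - i)) : ℤ)) =
      4 ^ n * catalan n := by
  have h := congrArg (PowerSeries.coeff n) PowerSeries.evenCatalanSeries_sq
  simpa [sq, PowerSeries.coeff_mul, Finset.Nat.sum_antidiagonal_eq_sum_range_succ_mk,
    PowerSeries.evenCatalanSeries, PowerSeries.coeff_rescale] using h

/-- The Catalan convolution identity
`Σ_{i=0}^{n-1} C_{2i+1} C_{2n-(2i+1)} = C_{2n+1} - 2^{2n} C_n`. -/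
theorem stmt16 (n : ℕ) :
    (∑ i ∈ Finset.range n,
        (catalan (2 * i + 1) * catalan (2 * n - (2 * i + 1)) : ℤ)) =
      catalan (2 * n + 1) - 2 ^ (2 * n) * catalan n := by
  have h := sum_catalan_two_mul_mul_catalan_two_mul n
  rw [catalan_two_mul_add_one, pow_mul]
  push_cast
  linear_combination -h
end

section
/- Let s, t, n be positive integers. The number of lattice paths from (0,0) with terminus (sn − 1, tn − 1) that lie weakly under the boundary word U^{t−1}(R^s U^t)^{n−1} R^{s−1} equals (1/n)·binomial((s+t)n − 2, tn − 1); equivalently, n times this number of paths equals binomial((s+t)n − 2, tn − 1). -/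
/-- The boundary word `U^{t-1}(R^s U^t)^{n-1} R^{s-1}`. -/
def bdryStaircase (s t n : ℕ) : List Bool :=
  List.replicate (t - 1) true ++
    (List.replicate (n - 1) (List.replicate s false ++ List.replicate t true)).flatten ++
    List.replicate (s - 1) false

open Finset

/-- `upRuns P m` is the number of U-steps of `P` between its `m`-th and `(m+1)`-st R-steps. -/
def upRuns : List Bool → ℕ → ℕ
  | [], _ => 0
  | false :: _, 0 => 0
  | false :: P, m + 1 => upRuns P m
  | true :: P, 0 => upRuns P 0 + 1
  | true :: P, m + 1 => upRuns P (m + 1)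

lemma sum_upRuns_true_cons (P : List Bool) (m : ℕ) :
    ∑ i ∈ range (m + 1), upRuns (true :: P) i = ∑ i ∈ range (m + 1), upRuns P i + 1 := by
  simp only [sum_range_succ', upRuns]
  ring

lemma sum_upRuns_false_cons (P : List Bool) (m : ℕ) :
    ∑ i ∈ range (m + 1), upRuns (false :: P) i = ∑ i ∈ range m, upRuns P i := by
  simp [sum_range_succ', upRuns]

lemma sum_upRuns_eq_count_true (P : List Bool) :
    ∑ i ∈ range (P.count false + 1), upRuns P i = P.count true := by
  induction P with
  | nil => simp [upRuns]
  | cons b P ih =>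
    cases b
    · simpa [sum_upRuns_false_cons] using ih
    · simpa [sum_upRuns_true_cons] using ih

lemma sum_upRuns_bounds_of_append (p r : List Bool) :
    ∑ i ∈ range (p.count false), upRuns (p ++ true :: r) i ≤ p.count true ∧
      p.count true < ∑ i ∈ range (p.count false + 1), upRuns (p ++ true :: r) i := by
  induction p with
  | nil => simp [upRuns]
  | cons b p ih =>
    cases b
    · simpa [sum_upRuns_false_cons] using ih
    · refine ⟨?_, by simpa [sum_upRuns_true_cons] using ih.2⟩
      rcases h : p.count false with _ | c
      · simp [h]
      · have := ih.1
        rw [h] at this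
        simpa [h, sum_upRuns_true_cons] using this

lemma eq_of_upRuns_eq {P Q : List Bool} (hc : P.count false = Q.count false)
    (h : ∀ m ≤ P.count false, upRuns P m = upRuns Q m) : P = Q := by
  induction P generalizing Q with
  | nil =>
    rcases Q with _ | ⟨_ | _, Q⟩
    · rfl
    · simp at hc
    · simpa [upRuns] using h 0
  | cons b P ih =>
    rcases b with _ | _ <;> rcases Q with _ | ⟨_ | _, Q⟩
    · simp at hc
    · rw [ih (by simpa using hc) fun m hm ↦ by simpa [upRuns] using h (m + 1) (by simpa using hm)]
    · simpa [upRuns] using h 0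
    · simpa [upRuns] using h 0
    · simpa [upRuns] using h 0
    · rw [ih (by simpa using hc) fun m hm ↦ ?_]
      have := h m (by simpa using hm)
      cases m <;> simpa [upRuns] using this

lemma upRuns_replicate_true_append_zero (a : ℕ) (P : List Bool) :
    upRuns (List.replicate a true ++ P) 0 = a + upRuns P 0 := by
  induction a with
  | zero => simp
  | succ a ih => simp only [List.replicate_succ, List.cons_append, upRuns, ih]; ring

lemma upRuns_replicate_true_append_succ (a : ℕ) (P : List Bool) (m : ℕ) :
    upRuns (List.replicate a true ++ P) (m + 1) = upRuns P (m + 1) := by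
  induction a with
  | zero => simp
  | succ a ih => simp only [List.replicate_succ, List.cons_append, upRuns, ih]

lemma exists_upRuns_eq (a : ℕ) (f : ℕ → ℕ) :
    ∃ P : List Bool, P.count false = a ∧ ∀ m ≤ a, upRuns P m = f m := by
  induction a generalizing f with
  | zero =>
    refine ⟨List.replicate (f 0) true ++ [], by simp [List.count_replicate], fun m hm ↦ ?_⟩
    rw [Nat.le_zero.mp hm, upRuns_replicate_true_append_zero]
    simp [upRuns]
  | succ a ih =>
    obtain ⟨P, hP, h⟩ := ih fun m ↦ f (m + 1)
    refine ⟨List.replicate (f 0) true ++ false :: P, by simp [List.count_replicate, hP],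
      fun m hm ↦ ?_⟩
    rcases m with _ | m
    · simp [upRuns_replicate_true_append_zero, upRuns]
    · rw [upRuns_replicate_true_append_succ, upRuns, h m (by omega)]

lemma exists_eq_append_true_cons {P : List Bool} {k : ℕ} (hk : k < P.count true) :
    ∃ p r : List Bool, P = p ++ true :: r ∧ p.count true = k := by
  induction P generalizing k with
  | nil => simp at hk
  | cons b P ih =>
    cases b
    · obtain ⟨p, r, rfl, h⟩ := ih (k := k) (by simpa using hk)
      exact ⟨false :: p, r, by simp, by simpa using h⟩
    · rcases k with _ | k
      · exact ⟨[], P, by simp, by simp⟩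
      · obtain ⟨p, r, rfl, h⟩ := ih (k := k) (by simpa using hk)
        exact ⟨true :: p, r, by simp, by simpa using h⟩

lemma count_true_bdryStaircase {s t n : ℕ} (ht : 0 < t) (hn : 0 < n) :
    (bdryStaircase s t n).count true = t * n - 1 := by
  obtain ⟨t, rfl⟩ := Nat.exists_eq_succ_of_ne_zero ht.ne'
  obtain ⟨n, rfl⟩ := Nat.exists_eq_succ_of_ne_zero hn.ne'
  simp [bdryStaircase, List.count_replicate, List.count_flatten]
  ring_nf
  omega

lemma in_block_or_tail_of_eq_append (s : ℕ) {a : ℕ} {p r L : List Bool}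
    (h : List.replicate s false ++ List.replicate a true ++ L = p ++ true :: r) :
    (p.count false = s ∧ p.count true < a) ∨
      ∃ q, L = q ++ true :: r ∧ p.count false = s + q.count false ∧
        p.count true = a + q.count true := by
  induction s generalizing p with
  | zero =>
    induction a generalizing p with
    | zero => exact Or.inr ⟨p, by simpa using h, by simp, by simp⟩
    | succ a ih =>
      rcases p with _ | ⟨b, p⟩
      · simp
      · simp only [List.replicate_succ, List.cons_append, List.replicate_zero, List.nil_append,
          List.cons.injEq] at h
        obtain ⟨rfl, h⟩ := h
        rcases ih (p := p) (by simpa using h) with ⟨h1, h2⟩ | ⟨q, rfl, h1, h2⟩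
        · left; simp_all
        · right; exact ⟨q, rfl, by simpa using h1, by simp [h2]; ring⟩
  | succ s ih =>
    rcases p with _ | ⟨b, p⟩
    · simp [List.replicate_succ] at h
    · simp only [List.replicate_succ, List.cons_append, List.cons.injEq] at h
      obtain ⟨rfl, h⟩ := h
      rcases ih (p := p) (by simpa using h) with ⟨h1, h2⟩ | ⟨q, rfl, h1, h2⟩
      · left; simp_all
      · right; exact ⟨q, rfl, by simp [h1]; ring, by simpa using h2⟩

lemma count_false_of_blocks_eq_append {s t n e : ℕ} (ht : 0 < t) {p r : List Bool}
    (h : (List.replicate n (List.replicate s false ++ List.replicate t true)).flatten ++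
      List.replicate e false = p ++ true :: r) :
    p.count false = s * (p.count true / t + 1) := by
  induction n generalizing p with
  | zero =>
    have : true ∈ List.replicate e false := by
      simp only [List.replicate_zero, List.flatten_nil, List.nil_append] at h
      simp [h]
    simp at this
  | succ n ih =>
    rw [List.replicate_succ, List.flatten_cons, List.append_assoc] at h
    rcases in_block_or_tail_of_eq_append s h with ⟨h1, h2⟩ | ⟨q, hq, h1, h2⟩
    · simp [h1, Nat.div_eq_of_lt h2]
    · rw [h1, h2, ih hq, Nat.add_div_left _ ht]
      ring

lemma count_false_of_bdryStaircase_eq_append {s t n : ℕ} (ht : 0 < t) {p r : List Bool}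
    (h : bdryStaircase s t n = p ++ true :: r) :
    p.count false = s * ((p.count true + 1) / t) := by
  rw [bdryStaircase, List.append_assoc] at h
  rcases in_block_or_tail_of_eq_append 0 (by simpa using h) with ⟨h1, h2⟩ | ⟨q, hq, h1, h2⟩
  · rw [h1, Nat.div_eq_of_lt (by omega), mul_zero]
  · rw [h1, h2, count_false_of_blocks_eq_append ht hq,
      show t - 1 + q.count true + 1 = t + q.count true by omega, Nat.add_div_left _ ht]
    ring

lemma underWord_bdryStaircase_iff {s t n : ℕ} (ht : 0 < t) (hn : 0 < n)
    {P : List Bool} (hs : s * n = P.count false + 1) (hU : P.count true = t * n - 1) :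
    UnderWord (bdryStaircase s t n) P ↔
      ∀ j, 0 < j → j < n → ∑ i ∈ range (s * j), upRuns P i < t * j := by
  have mono : Monotone fun m ↦ ∑ i ∈ range m, upRuns P i :=
    fun a b hab ↦ sum_le_sum_of_subset (range_mono hab)
  constructor
  · intro h j hj hjn
    by_contra! hle
    have hpos : 0 < t * j := by positivity
    have hlt : t * j < t * n := by gcongr
    obtain ⟨p, r, rfl, hp⟩ := exists_eq_append_true_cons (P := P) (k := t * j - 1) (by omega)
    obtain ⟨q, r', hq, hq'⟩ := exists_eq_append_true_cons (P := bdryStaircase s t n)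
      (k := t * j - 1) (by rw [count_true_bdryStaircase ht hn]; omega)
    have h1 := h q r' p r hq rfl (by omega)
    rw [count_false_of_bdryStaircase_eq_append ht hq, hq', Nat.sub_add_cancel hpos,
      Nat.mul_div_cancel_left _ ht] at h1
    have h2 := (sum_upRuns_bounds_of_append p r).1
    have h3 := mono h1
    dsimp only at h3
    omega
  · intro h pB rB pP rP hB hP hc
    rw [count_false_of_bdryStaircase_eq_append ht hB, ← hc]
    by_contra! hlt
    have h2 := (sum_upRuns_bounds_of_append pP rP).2
    rw [← hP] at h2
    have hk : pP.count true + 1 < t * n := by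
      have : P.count true = pP.count true + (rP.count true + 1) := by simp [hP]
      have : 0 < t * n := by positivity
      omega
    have hle : t * ((pP.count true + 1) / t) ≤ pP.count true + 1 := Nat.mul_div_le _ _
    have h3 := h ((pP.count true + 1) / t) (Nat.pos_of_ne_zero fun h0 ↦ by simp [h0] at hlt)
      (Nat.div_lt_of_lt_mul hk)
    have h4 := mono (Nat.succ_le_of_lt hlt)
    dsimp only [Nat.succ_eq_add_one] at h4
    omega

/-- Raney's cycle lemma, for the partial sums `D` of an `n`-periodic sequence of total `-1`. -/
lemma existsUnique_lt_of_add_period {n : ℕ} (hn : 0 < n) {D : ℕ → ℤ}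
    (hD : ∀ k, D (k + n) = D k - 1) :
    ∃! i, i < n ∧ ∀ j, 0 < j → j < n → D (i + j) < D i := by
  apply existsUnique_of_exists_of_unique
  · obtain ⟨m, hm, hmax⟩ := exists_max_image (range n) D ⟨0, by simpa using hn⟩
    classical
    have hne : ((range n).filter fun i ↦ D i = D m).Nonempty := ⟨m, by simp_all⟩
    obtain ⟨i, hi, hlast⟩ := exists_max_image _ id hne
    simp only [mem_filter, mem_range, id] at hi hlast hmax hm
    refine ⟨i, hi.1, fun j hj hjn ↦ ?_⟩
    by_cases hij : i + j < n
    · refine lt_of_le_of_ne (hi.2 ▸ hmax _ hij) fun h ↦ ?_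
      have := hlast (i + j) ⟨hij, h.trans hi.2⟩
      omega
    · have h1 := hD (i + j - n)
      rw [Nat.sub_add_cancel (by omega)] at h1
      have h2 := hmax (i + j - n) (by omega)
      omega
  · have key : ∀ a b, (∀ j, 0 < j → j < n → D (a + j) < D a) →
        (∀ j, 0 < j → j < n → D (b + j) < D b) → b < n → ¬ a < b := by
      intro a b ha hb hbn hab
      have h1 := ha (b - a) (by omega) (by omega)
      have h2 := hb (a + n - b) (by omega) (by omega)
      rw [show b + (a + n - b) = a + n by omega, hD] at h2
      rw [show a + (b - a) = b by omega] at h1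
      omega
    rintro a b ⟨ha, ha'⟩ ⟨hb, hb'⟩
    have := key a b ha' hb' hb
    have := key b a hb' ha' ha
    omega

/-- The `N`-periodic sequences of natural numbers with sum `M` over a period. -/
def periodicSeqs (N M : ℕ) : Set (ℕ → ℕ) :=
  {g | Function.Periodic g N ∧ ∑ i ∈ range N, g i = M}

lemma periodicSeqs_sum_add {N M : ℕ} {g : ℕ → ℕ} (hg : g ∈ periodicSeqs N M) (k : ℕ) :
    ∑ i ∈ range (k + N), g i = ∑ i ∈ range k, g i + M := by
  rw [add_comm k, sum_range_add, hg.2, add_comm]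
  congr 1
  exact sum_congr rfl fun i _ ↦ by rw [add_comm, hg.1]

lemma shift_mem_periodicSeqs {N M : ℕ} {g : ℕ → ℕ} (hg : g ∈ periodicSeqs N M) (k : ℕ) :
    (fun m ↦ g (k + m)) ∈ periodicSeqs N M := by
  refine ⟨fun m ↦ by simp only [← add_assoc, hg.1 _], ?_⟩
  have h1 := periodicSeqs_sum_add hg k
  rw [sum_range_add] at h1
  exact Nat.add_left_cancel h1

lemma card_periodicSeqs {N : ℕ} (hN : 0 < N) (M : ℕ) :
    Nat.card (periodicSeqs N M) = (N + M - 1).choose M := by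
  have e : Nat.card (periodicSeqs N M) = Nat.card {P : Fin N → ℕ // ∑ i, P i = M} := by
    refine Nat.card_eq_of_bijective
      (fun g ↦ ⟨fun i ↦ g.1 i, by rw [Fin.sum_univ_eq_sum_range (fun i ↦ g.1 i)]; exact g.2.2⟩)
      ⟨fun g h hgh ↦ ?_, fun f ↦ ?_⟩
    · ext m
      have := congr_fun (congr_arg Subtype.val hgh) ⟨m % N, Nat.mod_lt _ hN⟩
      simpa [g.2.1.map_mod_nat, h.2.1.map_mod_nat] using this
    · refine ⟨⟨fun m ↦ f.1 ⟨m % N, Nat.mod_lt _ hN⟩, fun m ↦ by simp, ?_⟩, ?_⟩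
      · rw [← Fin.sum_univ_eq_sum_range (fun m ↦ f.1 ⟨m % N, Nat.mod_lt _ hN⟩)]
        refine Eq.trans ?_ f.2
        exact sum_congr rfl fun i _ ↦ by simp [Nat.mod_eq_of_lt i.2]
      · ext i
        simp [Nat.mod_eq_of_lt i.2]
  rw [e, ← Nat.card_congr (Sym.equivNatSumOfFintype (Fin N) M), Nat.card_eq_fintype_card,
    Sym.card_sym_eq_choose, Fintype.card_fin]

/-- The sequences in `periodicSeqs (s * n) (t * n - 1)` whose first `s * j` terms add up to less
than `t * j`, for `0 < j < n`. -/
def ballotSeqs (s t n : ℕ) : Set (ℕ → ℕ) :=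
  {g | g ∈ periodicSeqs (s * n) (t * n - 1) ∧
    ∀ j, 0 < j → j < n → ∑ i ∈ range (s * j), g i < t * j}

lemma existsUnique_shift_mem_ballotSeqs {s t n : ℕ} (ht : 0 < t) (hn : 0 < n) {g : ℕ → ℕ}
    (hg : g ∈ periodicSeqs (s * n) (t * n - 1)) :
    ∃! i, i < n ∧ (fun m ↦ g (s * i + m)) ∈ ballotSeqs s t n := by
  have hpos : 0 < t * n := by positivity
  have := existsUnique_lt_of_add_period hn
    (D := fun k ↦ (∑ i ∈ range (s * k), g i : ℕ) - (t * k : ℕ)) fun k ↦ by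
      rw [mul_add, periodicSeqs_sum_add hg, mul_add]
      omega
  convert this using 4 with i
  simp only [ballotSeqs, Set.mem_ofPred_eq, shift_mem_periodicSeqs hg, true_and]
  refine forall₃_congr fun j _ _ ↦ ?_
  rw [mul_add, sum_range_add, mul_add]
  omega

lemma mul_card_ballotSeqs {s t n : ℕ} (ht : 0 < t) (hn : 0 < n) :
    n * Nat.card (ballotSeqs s t n) = Nat.card (periodicSeqs (s * n) (t * n - 1)) := by
  choose! φ hφ huniq using fun (g : ℕ → ℕ) hg ↦
    existsUnique_shift_mem_ballotSeqs (s := s) (t := t) (n := n) (g := g) ht hn hg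
  have hback : ∀ (g : ℕ → ℕ), Function.Periodic g (s * n) → ∀ i ≤ n, ∀ m,
      g (s * (n - i) + (s * i + m)) = g m := by
    intro g hg i hi m
    rw [← add_assoc, ← mul_add, Nat.sub_add_cancel hi, add_comm, hg]
  rw [← Nat.card_fin n, ← Nat.card_prod, Nat.card_fin]
  symm
  refine Nat.card_eq_of_bijective
    (fun g ↦ (⟨φ g.1, (hφ g.1 g.2).1⟩, ⟨_, (hφ g.1 g.2).2⟩)) ⟨?_, ?_⟩
  · rintro ⟨g, hg⟩ ⟨h, hh⟩ heq
    simp only [Prod.mk.injEq, Fin.mk.injEq, Subtype.mk.injEq] at heq ⊢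
    obtain ⟨h1, h2⟩ := heq
    have hle := (hφ h hh).1.le
    ext m
    have := congr_fun h2 (s * (n - φ h) + m)
    simp only [h1] at this
    have hcancel : s * φ h + (s * (n - φ h) + m) = m + s * n := by
      rw [← add_assoc, ← mul_add, Nat.add_sub_cancel' hle, add_comm]
    rwa [hcancel, hg.1, hh.1] at this
  · rintro ⟨⟨i, hi⟩, g, hg⟩
    have hmem := shift_mem_periodicSeqs hg.1 (s * (n - i))
    have hshift : (fun m ↦ g (s * (n - i) + (s * i + m))) = g :=
      funext fun m ↦ hback g hg.1.1 i hi.le m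
    have hi' : i = φ _ := huniq _ hmem i ⟨hi, by simpa only [hshift] using hg⟩
    refine ⟨⟨_, hmem⟩, ?_⟩
    simp only [← hi', hshift]

lemma card_underWord_bdryStaircase {s t n : ℕ} (hs : 0 < s) (ht : 0 < t) (hn : 0 < n) :
    Nat.card {P : List Bool //
        P.count false = s * n - 1 ∧ P.count true = t * n - 1 ∧
        UnderWord (bdryStaircase s t n) P} = Nat.card (ballotSeqs s t n) := by
  have hpos : 0 < s * n := by positivity
  have hsum : ∀ (f : ℕ → ℕ), ∀ k ≤ s * n,
      ∑ i ∈ range k, f (i % (s * n)) = ∑ i ∈ range k, f i := fun f k hk ↦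
    sum_congr rfl fun i hi ↦ by rw [Nat.mod_eq_of_lt (by simp at hi; omega)]
  refine Nat.card_eq_of_bijective
    (fun P ↦ ⟨fun m ↦ upRuns P.1 (m % (s * n)), ⟨fun m ↦ by simp, ?_⟩, fun j hj hjn ↦ ?_⟩)
    ⟨?_, ?_⟩
  · obtain ⟨P, h1, h2, h3⟩ := P
    have := sum_upRuns_eq_count_true P
    rw [h1, h2, Nat.sub_add_cancel hpos] at this
    rw [hsum _ _ le_rfl, this]
  · obtain ⟨P, h1, h2, h3⟩ := P
    rw [hsum _ _ (by gcongr)]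
    exact (underWord_bdryStaircase_iff (s := s) ht hn (by omega) h2).1 h3 j hj hjn
  · rintro ⟨P, hP, _⟩ ⟨Q, hQ, _⟩ h
    refine Subtype.ext (eq_of_upRuns_eq (hP.trans hQ.symm) fun m hm ↦ ?_)
    have hm' : m < s * n := by dsimp only at hm; omega
    have := congr_fun (congr_arg Subtype.val h) m
    simpa only [Nat.mod_eq_of_lt hm'] using this
  · rintro ⟨g, hg, hb⟩
    obtain ⟨P, hP, hPg⟩ := exists_upRuns_eq (s * n - 1) g
    have hsum' : ∀ k ≤ s * n, ∑ i ∈ range k, upRuns P i = ∑ i ∈ range k, g i := fun k hk ↦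
      sum_congr rfl fun i hi ↦ hPg i (by simp at hi; omega)
    have hU : P.count true = t * n - 1 := by
      rw [← sum_upRuns_eq_count_true, hP, Nat.sub_add_cancel hpos, hsum' _ le_rfl, hg.2]
    refine ⟨⟨P, hP, hU, (underWord_bdryStaircase_iff (s := s) ht hn (by omega) hU).2
      fun j hj hjn ↦ ?_⟩, ?_⟩
    · rw [hsum' _ (by gcongr)]
      exact hb j hj hjn
    · ext m
      have := Nat.mod_lt m hpos
      simp only [hPg (m % (s * n)) (by omega), hg.1.map_mod_nat]

theorem stmt17 (s t n : ℕ) (hs : 0 < s) (ht : 0 < t) (hn : 0 < n) :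
    n * Nat.card {P : List Bool //
        P.count false = s * n - 1 ∧ P.count true = t * n - 1 ∧
        UnderWord (bdryStaircase s t n) P} =
      ((s + t) * n - 2).choose (t * n - 1) := by
  rw [card_underWord_bdryStaircase hs ht hn, mul_card_ballotSeqs ht hn,
    card_periodicSeqs (by positivity)]
  have : 0 < t * n := by positivity
  congr 1
  rw [add_mul]
  omega
end

section
/- Let s, t, n be positive integers, and let S_{s,t} be the staircase lattice path that starts at the point (0, t) and consists of n repetitions of (s R-steps followed by t U-steps). The number of lattice paths from (0,0) with terminus (sn + 1, tn) that share no lattice point with S_{s,t} (i.e. that remain strictly below the staircase) equals (1/n)·binomial((s+t)n, tn − 1); equivalently, n times this number of paths equals binomial((s+t)n, tn − 1). -/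
/-- The staircase `S_{s,t}` as a word of steps (`false` = R-step, `true` = U-step):
`n` repetitions of (`s` R-steps followed by `t` U-steps).  As a path it starts at the
point `(0, t)`, so the lattice points it visits are the points
`(q.count false, t + q.count true)` for prefixes `q`. -/
def staircaseWord (s t n : ℕ) : List Bool :=
  (List.replicate n (List.replicate s false ++ List.replicate t true)).flatten


/-! ### Paths and their column heights -/

/-- The pair `(a, l)`, where `a` is the number of U-steps of a path before its first R-step and `l`
lists the numbers of U-steps following each of its R-steps. -/
def columnHeights : List Bool → ℕ × List ℕ
  | [] => (0, [])
  | true :: P => ((columnHeights P).1 + 1, (columnHeights P).2)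
  | false :: P => (0, (columnHeights P).1 :: (columnHeights P).2)

theorem columnHeights_injective : Function.Injective columnHeights := by
  intro P
  induction P with
  | nil =>
    rintro (_ | ⟨_ | _, Q⟩) h <;> simp_all [columnHeights]
  | cons b P ih =>
    rintro (_ | ⟨c, Q⟩) h
    · cases b <;> simp_all [columnHeights]
    · cases b <;> cases c <;> simp only [columnHeights, Prod.mk.injEq, List.cons.injEq] at h
      · simp [ih (Prod.ext h.2.1 h.2.2)]
      · omega
      · omega
      · simp [ih (Prod.ext (Nat.succ_injective h.1) h.2)]

theorem columnHeights_surjective : Function.Surjective columnHeights := by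
  rintro ⟨a, l⟩
  induction l generalizing a with
  | nil =>
    induction a with
    | zero => exact ⟨[], rfl⟩
    | succ a ih =>
      obtain ⟨P, hP⟩ := ih
      exact ⟨true :: P, by simp [columnHeights, hP]⟩
  | cons b l ihl =>
    induction a with
    | zero =>
      obtain ⟨P, hP⟩ := ihl b
      exact ⟨false :: P, by simp [columnHeights, hP]⟩
    | succ a ih =>
      obtain ⟨P, hP⟩ := ih
      exact ⟨true :: P, by simp [columnHeights, hP]⟩

theorem length_columnHeights (P : List Bool) : (columnHeights P).2.length = P.count false := by
  induction P with
  | nil => rfl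
  | cons b P ih => cases b <;> simp [columnHeights, ih]

theorem sum_columnHeights (P : List Bool) :
    (columnHeights P).1 + (columnHeights P).2.sum = P.count true := by
  induction P with
  | nil => rfl
  | cons b P ih => cases b <;> simp [columnHeights, ← ih]; omega

/-- For a predicate that is closed under moving down, all points of a path satisfy it as soon as
the topmost point of every column does. -/
theorem forall_prefix_iff_columnHeights {g : ℕ → ℕ → Prop}
    (hg : ∀ x y, g x (y + 1) → g x y) (P : List Bool) (x y : ℕ) :
    (∀ p, p <+: P → g (x + p.count false) (y + p.count true)) ↔
      ∀ k ≤ (columnHeights P).2.length,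
        g (x + k) (y + ((columnHeights P).1 + ((columnHeights P).2.take k).sum)) := by
  have down : ∀ d x y, g x (y + d) → g x y := by
    intro d
    induction d with
    | zero => exact fun _ _ h => h
    | succ d ih => exact fun x y h => ih x y (hg _ _ h)
  induction P generalizing x y with
  | nil => simp [columnHeights]
  | cons b P ih =>
    have split : (∀ p, p <+: b :: P → g (x + p.count false) (y + p.count true)) ↔
        g x y ∧ ∀ p, p <+: P →
          g (x + (b :: p).count false) (y + (b :: p).count true) := by
      constructor
      · intro h
        exact ⟨by simpa using h [] (by simp),
          fun p hp => h (b :: p) (List.cons_prefix_cons.2 ⟨rfl, hp⟩)⟩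
      · rintro ⟨h0, h1⟩ (_ | ⟨c, p⟩) hp
        · simpa using h0
        · obtain ⟨hc, hp'⟩ := List.cons_prefix_cons.1 hp
          exact hc ▸ h1 p hp'
    rw [split]
    cases b
    · have := ih (x + 1) y
      simp only [List.count_cons_self, ne_eq, reduceCtorEq, not_false_eq_true,
        List.count_cons_of_ne, columnHeights, List.length_cons]
      simp only [add_assoc, add_comm 1] at this
      refine (and_congr Iff.rfl this).trans ?_
      constructor
      · rintro ⟨h0, h1⟩ (_ | k) hk
        · simpa using h0
        · simpa using h1 k (by omega)
      · intro h
        refine ⟨by simpa using h 0 (by omega), fun k hk => ?_⟩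
        simpa using h (k + 1) (by omega)
    · have := ih x (y + 1)
      simp only [List.count_cons_self, ne_eq, reduceCtorEq, not_false_eq_true,
        List.count_cons_of_ne, columnHeights]
      simp only [add_assoc, add_comm 1] at this
      refine (and_congr Iff.rfl this).trans ?_
      constructor
      · rintro ⟨h0, h1⟩ k hk
        have := h1 k hk
        ring_nf at this ⊢
        exact this
      · intro h
        refine ⟨?_, fun k hk => ?_⟩
        · have := h 0 (by omega)
          exact down _ _ _ this
        · have := h k hk
          ring_nf at this ⊢
          exact this

/-! ### The staircase as a boundary -/

theorem staircaseWord_succ (s t n : ℕ) :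
    staircaseWord s t (n + 1) =
      (List.replicate s false ++ List.replicate t true) ++ staircaseWord s t n := by
  simp [staircaseWord, List.replicate_succ]

theorem staircaseWord_prefix_bounds {s t : ℕ} (hs : 0 < s) (n : ℕ) (q : List Bool)
    (hq : q <+: staircaseWord s t n) :
    q.count false ≤ s * n ∧ t * ((q.count false - 1) / s) ≤ q.count true := by
  induction n generalizing q with
  | zero => simp_all [staircaseWord]
  | succ n ih =>
    rw [staircaseWord_succ] at hq
    have hA := List.prefix_append (List.replicate s false ++ List.replicate t true)
      (staircaseWord s t n)
    rcases le_total q.length (List.replicate s false ++ List.replicate t true).length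
      with hlen | hlen
    · have hq := List.prefix_of_prefix_length_le hq hA hlen
      have h1 : q.count false ≤ s := by
        simpa [List.count_replicate] using hq.sublist.count_le false
      have h2 : (q.count false - 1) / s = 0 := Nat.div_eq_of_lt (by omega)
      rw [h2]
      exact ⟨by nlinarith, by simp⟩
    · obtain ⟨r, rfl⟩ := List.prefix_of_prefix_length_le hA hq hlen
      obtain ⟨h1, h2⟩ := ih r ((List.prefix_append_right_inj _).1 hq)
      have e1 : (List.replicate s false ++ List.replicate t true ++ r).count false =
          s + r.count false := by simp [List.count_replicate]
      have e2 : (List.replicate s false ++ List.replicate t true ++ r).count true =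
          t + r.count true := by simp [List.count_replicate]
      rw [e1, e2]
      refine ⟨by nlinarith, ?_⟩
      rcases Nat.eq_zero_or_pos (r.count false) with h0 | h0
      · have : (s + r.count false - 1) / s = 0 := Nat.div_eq_of_lt (by omega)
        simp [this]
      · have : (s + r.count false - 1) / s = (r.count false - 1) / s + 1 := by
          rw [← Nat.add_div_right _ hs]
          congr 1
          omega
        rw [this]
        nlinarith

theorem exists_prefix_staircaseWord_count {s : ℕ} (t : ℕ) (hs : 0 < s) (n x : ℕ)
    (hx : x ≤ s * n) :
    ∃ q, q <+: staircaseWord s t n ∧ q.count false = x ∧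
      q.count true = t * ((x - 1) / s) := by
  induction n generalizing x with
  | zero => exact ⟨[], by simp, by simp_all, by simp_all⟩
  | succ n ih =>
    rw [staircaseWord_succ]
    by_cases hxs : x ≤ s
    · refine ⟨List.replicate x false, ?_, by simp, ?_⟩
      · rw [List.append_assoc]
        refine List.IsPrefix.trans ?_ (List.prefix_append _ _)
        exact ⟨List.replicate (s - x) false, by simp [List.replicate_append_replicate, hxs]⟩
      · rw [Nat.div_eq_of_lt (by omega)]
        simp [List.count_replicate]
    · obtain ⟨q, hq, h1, h2⟩ := ih (x - s) (by rw [mul_add] at hx; omega)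
      refine ⟨_ ++ q, (List.prefix_append_right_inj _).2 hq, ?_, ?_⟩
      · simp [List.count_replicate, h1]
        omega
      · have : (x - 1) / s = (x - s - 1) / s + 1 := by
          rw [← Nat.add_div_right _ hs]
          congr 1
          omega
        simp [List.count_replicate, h2, this]
        ring

/-- A path avoids the staircase iff in every column up to `s * n` it stays strictly below it. -/
theorem avoids_staircaseWord_iff {s t : ℕ} (hs : 0 < s) (ht : 0 < t) (n : ℕ) (P : List Bool) :
    (∀ p : List Bool, p <+: P → ∀ q : List Bool, q <+: staircaseWord s t n →
        ¬(p.count false = q.count false ∧ p.count true = q.count true + t)) ↔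
      ∀ p : List Bool, p <+: P → p.count false ≤ s * n →
        p.count true < t * ((p.count false - 1) / s + 1) := by
  constructor
  · intro h p
    induction p using List.reverseRecOn with
    | nil => simpa using ht
    | append_singleton p b ih =>
      intro hp
      have ih := ih ((List.prefix_append _ _).trans hp)
      cases b
      · have e : (p ++ [false]).count true = p.count true := by simp
        rw [e, List.count_append, List.count_singleton_self]
        intro hx
        refine (ih (by omega)).trans_le ?_
        gcongr
        omega
      · have h := h _ hp
        have e : (p ++ [true]).count false = p.count false := by simp
        rw [e, List.count_append, List.count_singleton_self] at h ⊢
        intro hx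
        obtain ⟨q, hq, h1, h2⟩ := exists_prefix_staircaseWord_count t hs n _ hx
        have h := h q hq
        have ih := ih hx
        rw [h1, h2] at h
        rw [mul_add] at ih ⊢
        simp only [true_and] at h
        omega
  · rintro h p hp q hq ⟨h1, h2⟩
    obtain ⟨h3, h4⟩ := staircaseWord_prefix_bounds hs n q hq
    have := h p hp (by omega)
    rw [h1, h2, mul_add] at this
    omega

/-! ### Cyclic lemma -/

/-- If `S` increases by `D ≥ 0` over each period `n`, then the positive parts of the gaps between
`S i` and the subsequent values of `S` sum to `D` over a period. -/
theorem sum_card_lt_gap {n : ℕ} (hn : 0 < n) (S : ℕ → ℤ) (D : ℕ) (M : ℕ) (hD : D ≤ M)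
    (hS : ∀ k, S (k + n) = S k + D) :
    ∑ i ∈ Finset.range n,
      ((Finset.range M).filter fun a : ℕ =>
        ∀ j ∈ Finset.Icc (1 : ℕ) n, S i + a < S (i + j)).card = D := by
  have hne : (Finset.range n).Nonempty := ⟨0, by simpa⟩
  let F : ℕ → ℤ := fun i => (Finset.range n).inf' hne fun k => S (i + k)
  have lt_F : ∀ i v, v < F (i + 1) ↔ ∀ j ∈ Finset.Icc (1 : ℕ) n, v < S (i + j) := by
    intro i v
    simp only [F, Finset.lt_inf'_iff, Finset.mem_range, Finset.mem_Icc]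
    constructor
    · intro h j hj
      have := h (j - 1) (by omega)
      rwa [show i + 1 + (j - 1) = i + j by omega] at this
    · intro h k hk
      rw [add_assoc]
      exact h (1 + k) (by omega)
  have F_eq : ∀ i, F i = min (S i) (F (i + 1)) := by
    intro i
    refine eq_of_forall_lt_iff fun v => ?_
    rw [lt_min_iff, lt_F]
    simp only [F, Finset.lt_inf'_iff, Finset.mem_range, Finset.mem_Icc]
    constructor
    · intro h
      refine ⟨by simpa using h 0 hn, fun j hj => ?_⟩
      rcases hj.2.lt_or_eq with hj' | rfl
      · exact h j hj'
      · have := h 0 hn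
        have := hS i
        simp only [add_zero] at *
        omega
    · rintro ⟨h0, h1⟩ (_ | k) hk
      · simpa using h0
      · exact h1 _ (by omega)
  have F_le : ∀ i, F (i + 1) ≤ S i + D := by
    intro i
    by_contra! h
    have := (lt_F i _).1 h n (by simp; omega)
    rw [hS] at this
    omega
  have card_eq : ∀ i, (((Finset.range M).filter
      fun a : ℕ => ∀ j ∈ Finset.Icc (1 : ℕ) n, S i + a < S (i + j)).card : ℤ) =
        F (i + 1) - F i := by
    intro i
    have : ((Finset.range M).filter fun a : ℕ => ∀ j ∈ Finset.Icc (1 : ℕ) n, S i + a < S (i + j)) =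
        Finset.range (F (i + 1) - S i).toNat := by
      ext a
      have := F_le i
      rw [Finset.mem_filter, ← lt_F, Finset.mem_range, Finset.mem_range]
      omega
    rw [this, Finset.card_range, F_eq i]
    omega
  have F_n : F (0 + n) = F 0 + D := by
    refine eq_of_forall_lt_iff fun v => ?_
    rw [← sub_lt_iff_lt_add]
    simp only [F, Finset.lt_inf'_iff]
    refine forall₂_congr fun k _ => ?_
    rw [show 0 + n + k = 0 + k + n by omega, hS, sub_lt_iff_lt_add]
  zify
  rw [Finset.sum_congr rfl fun i _ => card_eq i, Finset.sum_range_sub]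
  simpa [sub_eq_iff_eq_add, add_comm] using F_n

/-! ### Counting column heights -/

theorem sum_tsub_sum_eq_choose (K L m : ℕ) (hm : m ≤ K) :
    ∑ h : Fin L → Fin K, (m - ∑ x, (h x : ℕ)) = (L + m).choose (L + 1) := by
  induction L generalizing m with
  | zero => simp
  | succ L ih =>
    rw [← (Fin.consEquiv fun _ => Fin K).sum_comp, Fintype.sum_prod_type]
    simp only [Fin.consEquiv_apply, Fin.sum_univ_succ, Fin.cons_zero, Fin.cons_succ,
      ← Nat.sub_sub]
    rw [Finset.sum_congr rfl fun (a : Fin K) _ => ih (m - (a : ℕ)) (by omega),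
      Fin.sum_univ_eq_sum_range (fun a => (L + (m - a)).choose (L + 1))]
    clear ih
    obtain ⟨d, rfl⟩ := Nat.exists_eq_add_of_le hm
    rw [Finset.sum_range_add]
    have : ∑ x ∈ Finset.range d, (L + (m - (m + x))).choose (L + 1) = 0 :=
      Finset.sum_eq_zero fun x _ => by simp
    rw [this, add_zero]
    clear this hm
    induction m with
    | zero => simp
    | succ m ih =>
      rw [Finset.sum_range_succ']
      simp only [Nat.add_sub_add_right, Nat.sub_zero]
      rw [ih, show L + 1 + (m + 1) = (L + (m + 1)) + 1 by ring, Nat.choose_succ_succ,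
        show L + 1 + m = L + (m + 1) by ring, add_comm]

theorem sum_take_ofFn_append {L : ℕ} [NeZero L] (f : Fin L → ℕ) (c k : ℕ) (hk : k ≤ L) :
    ((List.ofFn f ++ [c]).take k).sum = ∑ x ∈ Finset.range k, f (Fin.ofNat L x) := by
  induction k with
  | zero => simp
  | succ k ih =>
    rw [Finset.sum_range_succ, ← ih (by omega), List.sum_take_succ _ _ (by simp; omega)]
    congr 1
    rw [List.getElem_append_left (by simp; omega), List.getElem_ofFn]
    congr 1
    ext
    simp [Nat.mod_eq_of_lt hk]

theorem sum_range_ofNat {L : ℕ} [NeZero L] (f : Fin L → ℕ) :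
    ∑ x ∈ Finset.range L, f (Fin.ofNat L x) = ∑ x, f x := by
  rw [← Fin.sum_univ_eq_sum_range (fun x => f (Fin.ofNat L x))]
  simp

theorem forall_le_lt_ceil_iff {s : ℕ} (t n : ℕ) (hs : 0 < s) (hn : 0 < n) (H : ℕ → ℕ)
    (hH : Monotone H) :
    (∀ k ≤ s * n, H k < t * ((k - 1) / s + 1)) ↔ ∀ j ∈ Finset.Icc (1 : ℕ) n, H (s * j) < t * j := by
  constructor
  · intro h j hj
    rw [Finset.mem_Icc] at hj
    have := h (s * j) (by gcongr; exact hj.2)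
    have e : (s * j - 1) / s + 1 = j := by
      obtain ⟨i, rfl⟩ : ∃ i, j = i + 1 := ⟨j - 1, by omega⟩
      congr 1
      rw [show s * (i + 1) - 1 = s * i + (s - 1) by rw [mul_add]; omega,
        Nat.mul_add_div hs, Nat.div_eq_of_lt (by omega), add_zero]
    rwa [e] at this
  · intro h k hk
    refine (hH ?_).trans_lt (h ((k - 1) / s + 1) ?_)
    · have : k - 1 < s * ((k - 1) / s + 1) := Nat.lt_mul_div_succ (k - 1) hs
      omega
    · rw [Finset.mem_Icc]
      refine ⟨Nat.le_add_left _ _, ?_⟩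
      rw [Nat.succ_le_iff, Nat.div_lt_iff_lt_mul hs]
      have := Nat.mul_pos hs hn
      rw [mul_comm n]
      omega

/-- The paths below the staircase are counted by the heights of their columns `0, …, s * n`. -/
theorem card_avoids_staircaseWord {s t n : ℕ} (hs : 0 < s) (ht : 0 < t) (hn : 0 < n)
    [NeZero (s * n)] :
    Nat.card {P : List Bool //
        P.count false = s * n + 1 ∧ P.count true = t * n ∧
        ∀ p : List Bool, p <+: P → ∀ q : List Bool, q <+: staircaseWord s t n →
          ¬(p.count false = q.count false ∧ p.count true = q.count true + t)} =
      ∑ h : Fin (s * n) → Fin (t * n), ((Finset.range (t * n)).filter fun a : ℕ =>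
        ∀ j ∈ Finset.Icc (1 : ℕ) n,
          a + ∑ x ∈ Finset.range (s * j), (h (Fin.ofNat _ x) : ℕ) < t * j).card := by
  have mem_iff (P : List Bool) :
      (P.count false = s * n + 1 ∧ P.count true = t * n ∧
        ∀ p : List Bool, p <+: P → ∀ q : List Bool, q <+: staircaseWord s t n →
          ¬(p.count false = q.count false ∧ p.count true = q.count true + t)) ↔
      (columnHeights P).2.length = s * n + 1 ∧
        (columnHeights P).1 + (columnHeights P).2.sum = t * n ∧
        ∀ k ≤ s * n, (columnHeights P).1 + ((columnHeights P).2.take k).sum <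
          t * ((k - 1) / s + 1) := by
    have hg := forall_prefix_iff_columnHeights
      (g := fun x y => x ≤ s * n → y < t * ((x - 1) / s + 1)) (by intros; grind) P 0 0
    simp only [zero_add] at hg
    rw [avoids_staircaseWord_iff hs ht, hg, sum_columnHeights, length_columnHeights]
    refine and_congr_right fun h1 => and_congr_right fun _ => ?_
    rw [h1]
    exact ⟨fun h k hk => h k (by omega) hk, fun h k _ hk => h k hk⟩
  have heights_iff (h : Fin (s * n) → Fin (t * n)) (a c : ℕ) :
      (∀ k ≤ s * n, a + ((List.ofFn (fun x => (h x : ℕ)) ++ [c]).take k).sum <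
          t * ((k - 1) / s + 1)) ↔
        ∀ j ∈ Finset.Icc (1 : ℕ) n,
          a + ∑ x ∈ Finset.range (s * j), (h (Fin.ofNat _ x) : ℕ) < t * j := by
    rw [← forall_le_lt_ceil_iff t n hs hn
      (fun k => a + ∑ x ∈ Finset.range k, (h (Fin.ofNat _ x) : ℕ))]
    · refine forall₂_congr fun k hk => ?_
      rw [sum_take_ofFn_append _ _ _ hk]
    · intro k k' hk
      dsimp only
      gcongr
  rw [← Finset.card_sigma, ← Nat.card_eq_finsetCard]
  let e := Equiv.ofBijective columnHeights ⟨columnHeights_injective, columnHeights_surjective⟩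
  let f (z : (_ : Fin (s * n) → Fin (t * n)) × ℕ) : ℕ × List ℕ :=
    (z.2, List.ofFn (fun x => (z.1 x : ℕ)) ++ [t * n - z.2 - ∑ x, (z.1 x : ℕ)])
  have he (w : ℕ × List ℕ) : columnHeights (e.symm w) = w := e.apply_symm_apply w
  symm
  refine Nat.card_eq_of_bijective
    (fun z => ⟨e.symm (f z.1), (mem_iff _).2 ?_⟩) ⟨?_, ?_⟩
  · obtain ⟨⟨h, a⟩, hz⟩ := z
    simp only [Finset.mem_sigma, Finset.mem_univ, Finset.mem_filter, true_and] at hz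
    rw [he]
    refine ⟨by simp [f], ?_, (heights_iff h a _).2 hz.2⟩
    have hlast := hz.2 n (by simp; omega)
    rw [sum_range_ofNat fun x => (h x : ℕ)] at hlast
    simp only [f, List.sum_append, List.sum_ofFn, List.sum_singleton]
    omega
  · rintro ⟨⟨h, a⟩, hz⟩ ⟨⟨h', a'⟩, hz'⟩ heq
    have hval : e.symm (f ⟨h, a⟩) = e.symm (f ⟨h', a'⟩) := congrArg Subtype.val heq
    have heq := e.symm.injective hval
    simp only [f, Prod.mk.injEq] at heq
    obtain ⟨rfl, heq⟩ := heq
    have := List.ofFn_injective (List.append_inj_left' heq rfl)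
    obtain rfl : h = h' := funext fun x => Fin.ext (congrFun this x)
    rfl
  · rintro ⟨P, hP⟩
    obtain ⟨hlen, hsum, hlt⟩ := (mem_iff P).1 hP
    obtain ⟨l, c, hl⟩ : ∃ l c, (columnHeights P).2 = l ++ [c] :=
      (List.eq_nil_or_concat' _).resolve_left (by rintro h; simp [h] at hlen)
    have hll : l.length = s * n := by simpa [hl] using hlen
    have hlast : (columnHeights P).1 + l.sum < t * n := by
      have := (forall_le_lt_ceil_iff t n hs hn
        (fun k => (columnHeights P).1 + ((columnHeights P).2.take k).sum) ?_).1 hlt n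
          (by simp; omega)
      · simpa [hl, ← hll] using this
      · exact fun k k' hk => Nat.add_le_add_left
          ((List.take_sublist_take_left hk).sum_le_sum (by simp)) _
    let h : Fin (s * n) → Fin (t * n) := fun x =>
      ⟨l[(x : ℕ)], ((List.single_le_sum (by simp) _ (List.getElem_mem _)).trans
        (Nat.le_add_left _ _)).trans_lt hlast⟩
    have hofFn : List.ofFn (fun x => (h x : ℕ)) = l :=
      List.ext_getElem (by simp [hll]) (by simp [h])
    have hf : f ⟨h, (columnHeights P).1⟩ = columnHeights P := by
      refine Prod.ext rfl ?_
      have hsum_h : ∑ x, (h x : ℕ) = l.sum := by rw [← hofFn, List.sum_ofFn]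
      simp only [f, hofFn, hl, hsum_h]
      rw [hl, List.sum_append, List.sum_singleton] at hsum
      congr 2
      omega
    refine ⟨⟨⟨h, (columnHeights P).1⟩, ?_⟩, ?_⟩
    · simp only [Finset.mem_sigma, Finset.mem_univ, Finset.mem_filter, true_and,
        Finset.mem_range]
      refine ⟨by omega, (heights_iff h _ c).1 ?_⟩
      rwa [hofFn, ← hl]
    · refine Subtype.ext ?_
      simp only [hf]
      exact e.symm_apply_apply P

theorem stmt19 (s t n : ℕ) (hs : 0 < s) (ht : 0 < t) (hn : 0 < n) :
    n * Nat.card {P : List Bool //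
        P.count false = s * n + 1 ∧ P.count true = t * n ∧
        ∀ p : List Bool, p <+: P → ∀ q : List Bool, q <+: staircaseWord s t n →
          ¬(p.count false = q.count false ∧ p.count true = q.count true + t)} =
      ((s + t) * n).choose (t * n - 1) := by
  have hL : 0 < s * n := Nat.mul_pos hs hn
  have hM : 0 < t * n := Nat.mul_pos ht hn
  have : NeZero (s * n) := ⟨hL.ne'⟩
  rw [card_avoids_staircaseWord hs ht hn]
  have rot (i : ℕ) : ∑ h : Fin (s * n) → Fin (t * n), ((Finset.range (t * n)).filter fun a : ℕ =>
        ∀ j ∈ Finset.Icc (1 : ℕ) n,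
          a + ∑ x ∈ Finset.range (s * j), (h (Fin.ofNat _ x) : ℕ) < t * j).card =
      ∑ h : Fin (s * n) → Fin (t * n), ((Finset.range (t * n)).filter fun a : ℕ =>
        ∀ j ∈ Finset.Icc (1 : ℕ) n,
          a + ∑ x ∈ Finset.range (s * j), (h (Fin.ofNat _ (s * i + x)) : ℕ) < t * j).card := by
    rw [← (Equiv.arrowCongr (Equiv.addLeft (Fin.ofNat (s * n) (s * i))).symm
      (Equiv.refl (Fin (t * n)))).sum_comp]
    have (x : ℕ) : Fin.ofNat (s * n) (s * i) + Fin.ofNat (s * n) x =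
        Fin.ofNat (s * n) (s * i + x) := by
      ext
      simp [Fin.val_add]
    simp only [Equiv.arrowCongr_apply, Equiv.symm_symm, Equiv.coe_addLeft, Equiv.coe_refl,
      Function.comp_apply, id_eq, this]
  have rot_sum := Finset.sum_congr (s₁ := Finset.range n) rfl fun i _ => rot i
  rw [Finset.sum_const, Finset.card_range, smul_eq_mul] at rot_sum
  rw [rot_sum, Finset.sum_comm]
  have total (h : Fin (s * n) → Fin (t * n)) :
      ∑ i ∈ Finset.range n, ((Finset.range (t * n)).filter fun a : ℕ =>
        ∀ j ∈ Finset.Icc (1 : ℕ) n,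
          a + ∑ x ∈ Finset.range (s * j), (h (Fin.ofNat _ (s * i + x)) : ℕ) < t * j).card =
      t * n - ∑ x, (h x : ℕ) := by
    let T (k : ℕ) : ℕ := ∑ x ∈ Finset.range k, (h (Fin.ofNat _ x) : ℕ)
    have hT : T (s * n) = ∑ x, (h x : ℕ) := sum_range_ofNat fun x => (h x : ℕ)
    have T_add (i k : ℕ) :
        T (i + k) = T i + ∑ x ∈ Finset.range k, (h (Fin.ofNat _ (i + x)) : ℕ) :=
      Finset.sum_range_add _ _ _
    have T_period (k : ℕ) : T (k + s * n) = T k + T (s * n) := by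
      rw [add_comm k, T_add, add_comm]
      congr 1
      refine Finset.sum_congr rfl fun x _ => ?_
      congr 2
      ext
      simp
    rcases le_total (T (s * n)) (t * n) with hle | hle
    · rw [← hT, ← sum_card_lt_gap hn (fun k => (t * k : ℤ) - T (s * k)) (t * n - T (s * n)) (t * n)
        (Nat.sub_le _ _)]
      · refine Finset.sum_congr rfl fun i _ => ?_
        congr 1
        refine Finset.filter_congr fun a _ => forall₂_congr fun j _ => ?_
        rw [mul_add, T_add]
        push_cast
        zify
        rw [mul_add]
        constructor <;> intro <;> linarith
      · intro k
        rw [mul_add, T_period]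
        push_cast [hle]
        ring
    · rw [← hT, Nat.sub_eq_zero_of_le hle]
      refine Finset.sum_eq_zero fun i _ => ?_
      rw [Finset.card_eq_zero, Finset.filter_eq_empty_iff]
      intro a _ H
      have h1 := H n (by simp; omega)
      have h2 := T_add (s * i) (s * n)
      rw [T_period] at h2
      omega
  rw [Finset.sum_congr rfl fun h _ => total h, sum_tsub_sum_eq_choose _ _ _ le_rfl,
    ← Nat.choose_symm_of_eq_add (a := t * n - 1) (by omega), add_mul]
end
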